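/- Let C ⊂ ℝ³ be a convex body and r₀ ∈ ∂C a ridge point whose tangent cone is the dihedral angle {r : (r − r₀, e₁) ≤ 0, (r − r₀, e₂) ≤ 0}, and let e = λ₁e₁ + λ₂e₂ with λ₁ > 0, λ₂ > 0, |e| = 1. Then every partial weak limit of the normalized surface measures ν_t as t → 0⁺ is supported in the arc Γ = {μ₁e₁ + μ₂e₂ : |μ₁e₁ + μ₂e₂| = 1, μ₁ ≥ 0, μ₂ ≥ 0} ⊂ S². -/

import Mathlib

open MeasureTheory Set Filter Topology
open scoped RealInnerProductSpace ENNReal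

noncomputable section

attribute [local instance] Classical.propDecidable

abbrev E3 := EuclideanSpace ℝ (Fin 3)

/-- A convex body: a compact convex set with nonempty interior. -/
def IsConvexBody (C : Set E3) : Prop :=
  IsCompact C ∧ Convex ℝ C ∧ (interior C).Nonempty

/-- The tangent cone to a convex set `C` at the point `r₀`: the closure of the set of
rays from `r₀` through points of `C`, translated to the origin. -/
def tanCone (C : Set E3) (r₀ : E3) : Set E3 :=
  closure {v : E3 | ∃ c : ℝ, ∃ r ∈ C, 0 ≤ c ∧ v = c • (r - r₀)}

/-- The dihedral angle `{v : ⟪v,e₁⟫ ≤ 0, ⟪v,e₂⟫ ≤ 0}` (as a cone of displacements). -/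
def dihedral (e₁ e₂ : E3) : Set E3 := {v : E3 | ⟪v, e₁⟫ ≤ 0 ∧ ⟪v, e₂⟫ ≤ 0}

/-- `n` is an outward unit normal of `C` at `r`. -/
def IsOutwardNormalAt (C : Set E3) (r n : E3) : Prop :=
  ‖n‖ = 1 ∧ ∀ x ∈ C, ⟪x - r, n⟫ ≤ 0

/-- `r` is a regular boundary point: the outward unit normal exists and is unique. -/
def IsRegularPt (C : Set E3) (r : E3) : Prop :=
  ∃! n : E3, IsOutwardNormalAt C r n

/-- The (Gauss) normal map of `C`, sending a boundary point to an outward unit normal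
(the unique one at regular points), and junk value `0` elsewhere. -/
def normalMap (C : Set E3) (r : E3) : E3 :=
  if h : ∃ n : E3, IsOutwardNormalAt C r n then h.choose else 0

/-- `B_t = C ∩ {r : ⟪r - r₀, e⟫ = -t}`. -/
def Bset (C : Set E3) (r₀ e : E3) (t : ℝ) : Set E3 :=
  C ∩ {r : E3 | ⟪r - r₀, e⟫ = -t}

/-- `S_t = ∂C ∩ {r : ⟪r - r₀, e⟫ ≥ -t}`. -/
def Sset (C : Set E3) (r₀ e : E3) (t : ℝ) : Set E3 :=
  frontier C ∩ {r : E3 | ⟪r - r₀, e⟫ ≥ -t}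

/-- The normalized surface measure `ν_t` induced by `S_t`: the pushforward under the
normal map of the 2-dimensional Hausdorff measure restricted to the regular points of
`S_t`, normalized by the area of `B_t`. -/
def nuT (C : Set E3) (r₀ e : E3) (t : ℝ) : Measure E3 :=
  (μH[2] (Bset C r₀ e t))⁻¹ •
    Measure.map (normalMap C) (μH[2].restrict (Sset C r₀ e t ∩ {r : E3 | IsRegularPt C r}))

/-- The arc `Γ = {μ₁e₁ + μ₂e₂ : |μ₁e₁ + μ₂e₂| = 1, μ₁ ≥ 0, μ₂ ≥ 0}`. -/
def arcGamma (e₁ e₂ : E3) : Set E3 :=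
  {v : E3 | ∃ m₁ m₂ : ℝ, 0 ≤ m₁ ∧ 0 ≤ m₂ ∧ v = m₁ • e₁ + m₂ • e₂ ∧ ‖v‖ = 1}

/-- Weak convergence of the family `ν t` to `ν₀` as `t → 0⁺`. -/
def WeaklyTendsto (ν : ℝ → Measure E3) (ν₀ : Measure E3) : Prop :=
  ∀ f : BoundedContinuousFunction E3 ℝ,
    Tendsto (fun t => ∫ x, f x ∂(ν t)) (𝓝[>] (0 : ℝ)) (𝓝 (∫ x, f x ∂ν₀))

/-- `ν₀` is a partial weak limit of the family `ν t` as `t → 0⁺`. -/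
def IsPartialWeakLimit (ν : ℝ → Measure E3) (ν₀ : Measure E3) : Prop :=
  ∃ ts : ℕ → ℝ, (∀ i, 0 < ts i) ∧ Tendsto ts atTop (𝓝 (0 : ℝ)) ∧
    ∀ f : BoundedContinuousFunction E3 ℝ,
      Tendsto (fun i => ∫ x, f x ∂(ν (ts i))) atTop (𝓝 (∫ x, f x ∂ν₀))

/-- The support of a measure: points all of whose open neighborhoods have positive measure. -/
def msupport (ν : Measure E3) : Set E3 :=
  {x : E3 | ∀ U : Set E3, IsOpen U → x ∈ U → 0 < ν U}

/-- coordinate of `r` w.r.t. covector `-a`, based at `r₀` -/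
def co (r₀ a r : E3) : ℝ := -⟪r - r₀, a⟫

/-- pair of coordinates -/
def pr (r₀ a b r : E3) : Fin 2 → ℝ := ![co r₀ a r, co r₀ b r]

/-- a dual pair of frames (up to sign), with norm bound `M` -/
structure DualFrame (e₁ e₂ e₃ u₁ u₂ u₃ : E3) (M : ℝ) : Prop where
  dec : ∀ v : E3, v = (-⟪v, e₁⟫) • u₁ + (-⟪v, e₂⟫) • u₂ + (-⟪v, e₃⟫) • u₃
  h11 : ⟪u₁, e₁⟫ = -1
  h12 : ⟪u₁, e₂⟫ = 0
  h13 : ⟪u₁, e₃⟫ = 0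
  h21 : ⟪u₂, e₁⟫ = 0
  h22 : ⟪u₂, e₂⟫ = -1
  h23 : ⟪u₂, e₃⟫ = 0
  h31 : ⟪u₃, e₁⟫ = 0
  h32 : ⟪u₃, e₂⟫ = 0
  h33 : ⟪u₃, e₃⟫ = -1
  hM : 1 ≤ M
  ne1 : ‖e₁‖ ≤ M
  ne2 : ‖e₂‖ ≤ M
  ne3 : ‖e₃‖ ≤ M
  nu1 : ‖u₁‖ ≤ M
  nu2 : ‖u₂‖ ≤ M
  nu3 : ‖u₃‖ ≤ M

section frame
variable {e₁ e₂ e₃ u₁ u₂ u₃ : E3} {M : ℝ}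

lemma DualFrame.swap (F : DualFrame e₁ e₂ e₃ u₁ u₂ u₃ M) : DualFrame e₂ e₁ e₃ u₂ u₁ u₃ M where
  dec v := by conv_lhs => rw [F.dec v]
              abel
  h11 := F.h22
  h12 := F.h21
  h13 := F.h23
  h21 := F.h12
  h22 := F.h11
  h23 := F.h13
  h31 := F.h32
  h32 := F.h31
  h33 := F.h33
  hM := F.hM
  ne1 := F.ne2
  ne2 := F.ne1
  ne3 := F.ne3
  nu1 := F.nu2
  nu2 := F.nu1
  nu3 := F.nu3

lemma DualFrame.rot (F : DualFrame e₁ e₂ e₃ u₁ u₂ u₃ M) : DualFrame e₃ e₁ e₂ u₃ u₁ u₂ M where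
  dec v := by conv_lhs => rw [F.dec v]
              abel
  h11 := F.h33
  h12 := F.h31
  h13 := F.h32
  h21 := F.h13
  h22 := F.h11
  h23 := F.h12
  h31 := F.h23
  h32 := F.h21
  h33 := F.h22
  hM := F.hM
  ne1 := F.ne3
  ne2 := F.ne1
  ne3 := F.ne2
  nu1 := F.nu3
  nu2 := F.nu1
  nu3 := F.nu2

lemma DualFrame.norm_le (F : DualFrame e₁ e₂ e₃ u₁ u₂ u₃ M) (r₀ r r' : E3) :
    ‖r - r'‖ ≤ M * (|co r₀ e₁ r - co r₀ e₁ r'| + |co r₀ e₂ r - co r₀ e₂ r'|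
      + |co r₀ e₃ r - co r₀ e₃ r'|) := by
  have h : ∀ a : E3, co r₀ a r - co r₀ a r' = -⟪r - r', a⟫ := by
    intro a
    simp only [co, inner_sub_left]; ring
  rw [h, h, h]
  have hM := F.hM
  conv_lhs => rw [F.dec (r - r')]
  refine (norm_add₃_le).trans ?_
  simp only [norm_smul, Real.norm_eq_abs]
  have h1 := mul_le_mul_of_nonneg_left F.nu1 (abs_nonneg (-⟪r - r', e₁⟫))
  have h2 := mul_le_mul_of_nonneg_left F.nu2 (abs_nonneg (-⟪r - r', e₂⟫))
  have h3 := mul_le_mul_of_nonneg_left F.nu3 (abs_nonneg (-⟪r - r', e₃⟫))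
  linarith

lemma DualFrame.inner_eq (F : DualFrame e₁ e₂ e₃ u₁ u₂ u₃ M) (r₀ r r' n : E3) :
    ⟪r - r', n⟫ = (co r₀ e₁ r - co r₀ e₁ r') * ⟪n, u₁⟫ + (co r₀ e₂ r - co r₀ e₂ r') * ⟪n, u₂⟫
      + (co r₀ e₃ r - co r₀ e₃ r') * ⟪n, u₃⟫ := by
  have h : ∀ a : E3, co r₀ a r - co r₀ a r' = -⟪r - r', a⟫ := by
    intro a
    simp only [co, inner_sub_left]; ring
  rw [h, h, h]
  conv_lhs => rw [F.dec (r - r')]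
  rw [real_inner_comm]
  simp only [inner_add_right, inner_smul_right]

lemma DualFrame.dec' (F : DualFrame e₁ e₂ e₃ u₁ u₂ u₃ M) (n : E3) :
    n = (-⟪n, u₁⟫) • e₁ + (-⟪n, u₂⟫) • e₂ + (-⟪n, u₃⟫) • e₃ := by
  refine ext_inner_left ℝ fun v => ?_
  conv_lhs => rw [F.dec v]
  rw [real_inner_comm]
  simp only [inner_add_right, inner_smul_right]
  ring

/-- the point with given coordinates -/
def pt (r₀ u₁ u₂ u₃ : E3) (x y z : ℝ) : E3 := r₀ + (x • u₁ + y • u₂ + z • u₃)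

lemma DualFrame.co1 (F : DualFrame e₁ e₂ e₃ u₁ u₂ u₃ M) (r₀ : E3) (x y z : ℝ) :
    co r₀ e₁ (pt r₀ u₁ u₂ u₃ x y z) = x := by
  simp [co, pt, inner_add_left, inner_smul_left, F.h11, F.h21, F.h31]

lemma DualFrame.co2 (F : DualFrame e₁ e₂ e₃ u₁ u₂ u₃ M) (r₀ : E3) (x y z : ℝ) :
    co r₀ e₂ (pt r₀ u₁ u₂ u₃ x y z) = y := by
  simp [co, pt, inner_add_left, inner_smul_left, F.h12, F.h22, F.h32]

lemma DualFrame.co3 (F : DualFrame e₁ e₂ e₃ u₁ u₂ u₃ M) (r₀ : E3) (x y z : ℝ) :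
    co r₀ e₃ (pt r₀ u₁ u₂ u₃ x y z) = z := by
  simp [co, pt, inner_add_left, inner_smul_left, F.h13, F.h23, F.h33]

lemma DualFrame.pt_co (F : DualFrame e₁ e₂ e₃ u₁ u₂ u₃ M) (r₀ r : E3) :
    pt r₀ u₁ u₂ u₃ (co r₀ e₁ r) (co r₀ e₂ r) (co r₀ e₃ r) = r := by
  have := F.dec (r - r₀)
  simp only [pt, co]
  rw [← this]; simp

end frame

lemma abs_inner_le_M {n u : E3} {M : ℝ} (hn : ‖n‖ = 1) (hu : ‖u‖ ≤ M) : |⟪n, u⟫| ≤ M := by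
  have := abs_real_inner_le_norm n u
  rw [hn, one_mul] at this
  exact this.trans hu

lemma haus_le {X Y Z : Type*} [MetricSpace Y] [MeasurableSpace Y] [BorelSpace Y]
    [MetricSpace Z] [MeasurableSpace Z] [BorelSpace Z] (φ : X → Y) (ψ : X → Z) (A : Set X)
    (Q : ℝ) (hQ : 0 ≤ Q)
    (h : ∀ r ∈ A, ∀ r' ∈ A, dist (φ r) (φ r') ≤ Q * dist (ψ r) (ψ r')) :
    μH[2] (φ '' A) ≤ ENNReal.ofReal Q ^ 2 * μH[2] (ψ '' A) := by
  rcases A.eq_empty_or_nonempty with rfl | ⟨a₀, ha₀⟩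
  · simp
  have : Nonempty X := ⟨a₀⟩
  set g : Z → Y := fun w => φ (Function.invFunOn ψ A w) with hg
  have hinv : ∀ w ∈ ψ '' A, Function.invFunOn ψ A w ∈ A ∧ ψ (Function.invFunOn ψ A w) = w :=
    fun w hw => ⟨Function.invFunOn_mem hw, Function.invFunOn_eq hw⟩
  have hlip : LipschitzOnWith Q.toNNReal g (ψ '' A) := by
    refine LipschitzOnWith.of_dist_le_mul ?_
    intro w hw w' hw'
    have := h _ (hinv w hw).1 _ (hinv w' hw').1
    rw [(hinv w hw).2, (hinv w' hw').2] at this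
    rwa [Real.coe_toNNReal _ hQ]
  have himg : φ '' A ⊆ g '' (ψ '' A) := by
    rintro _ ⟨r, hr, rfl⟩
    refine ⟨ψ r, ⟨r, hr, rfl⟩, ?_⟩
    have hw : ψ r ∈ ψ '' A := ⟨r, hr, rfl⟩
    have := h _ (hinv _ hw).1 _ hr
    rw [(hinv _ hw).2, dist_self, mul_zero] at this
    exact dist_le_zero.1 this
  refine (measure_mono himg).trans ((hlip.hausdorffMeasure_image_le (by norm_num)).trans ?_)
  have : ((Q.toNNReal : ℝ≥0∞) ^ (2:ℝ)) = ENNReal.ofReal Q ^ 2 := by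
    rw [ENNReal.rpow_two]; rfl
  rw [this]

lemma vol2 : (μH[2] : Measure (Fin 2 → ℝ)) = volume := by
  have := hausdorffMeasure_pi_real (ι := Fin 2)
  simpa using this

lemma slope_aux {p q m p' q' m' a b c M ε : ℝ} (h : a * p + b * q + c * m ≤ 0)
    (h' : 0 ≤ a * p' + b * q' + c * m') (hq : |q| ≤ M) (hm : |m| ≤ M) (hq' : |q'| ≤ M)
    (hm' : |m'| ≤ M) (hp : ε ≤ p) (hp' : ε ≤ p') :
    |a| * ε ≤ M * (|b| + |c|) := by
  have k : ∀ x y : ℝ, |y| ≤ M → |x * y| ≤ M * |x| := by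
    intro x y hy
    rw [abs_mul, mul_comm]
    exact mul_le_mul_of_nonneg_right hy (abs_nonneg _)
  have k1 := abs_le.1 (k b q hq)
  have k2 := abs_le.1 (k c m hm)
  have k3 := abs_le.1 (k b q' hq')
  have k4 := abs_le.1 (k c m' hm')
  rcases le_total 0 a with ha | ha
  · rw [abs_of_nonneg ha]
    have := mul_le_mul_of_nonneg_left hp ha
    nlinarith [k1.1, k2.1]
  · rw [abs_of_nonpos ha]
    have := mul_le_mul_of_nonneg_left hp' (neg_nonneg.2 ha)
    nlinarith [k3.2, k4.2]

lemma slope_signed {p q m p' q' m' a b c M ε σ : ℝ} (hσ : σ = 1 ∨ σ = -1)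
    (h : a * p + b * q + c * m ≤ 0)
    (h' : 0 ≤ a * p' + b * q' + c * m') (hq : |q| ≤ M) (hm : |m| ≤ M) (hq' : |q'| ≤ M)
    (hm' : |m'| ≤ M) (hp : ε ≤ σ * p) (hp' : ε ≤ σ * p') :
    |a| * ε ≤ M * (|b| + |c|) := by
  rcases hσ with rfl | rfl
  · exact slope_aux h h' hq hm hq' hm' (by linarith) (by linarith)
  · rw [← abs_neg a]
    exact slope_aux (p := -p) (p' := -p') (by linarith) (by linarith) hq hm hq' hm'
      (by linarith) (by linarith)

lemma DualFrame.slope_pts {e₁ e₂ e₃ u₁ u₂ u₃ : E3} {M : ℝ} (F : DualFrame e₁ e₂ e₃ u₁ u₂ u₃ M)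
    {C : Set E3} (r₀ : E3) {r r' n n' : E3} (hr : r ∈ C) (hr' : r' ∈ C)
    (hn : IsOutwardNormalAt C r n) (hn' : IsOutwardNormalAt C r' n') {σ ε : ℝ}
    (hσ : σ = 1 ∨ σ = -1) (hp : ε ≤ σ * ⟪n, u₁⟫) (hp' : ε ≤ σ * ⟪n', u₁⟫) :
    |co r₀ e₁ r - co r₀ e₁ r'| * ε ≤
      M * (|co r₀ e₂ r - co r₀ e₂ r'| + |co r₀ e₃ r - co r₀ e₃ r'|) := by
  have h1 := hn'.2 r hr
  have h2 := hn.2 r' hr'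
  rw [F.inner_eq r₀] at h1 h2
  exact slope_signed hσ h1 (by linarith) (abs_inner_le_M hn'.1 F.nu2) (abs_inner_le_M hn'.1 F.nu3)
    (abs_inner_le_M hn.1 F.nu2) (abs_inner_le_M hn.1 F.nu3) hp' hp

lemma abs_pr0 (r₀ a b r r' : E3) :
    |co r₀ a r - co r₀ a r'| ≤ dist (pr r₀ a b r) (pr r₀ a b r') := by
  have := dist_le_pi_dist (pr r₀ a b r) (pr r₀ a b r') 0
  simpa [pr, Real.dist_eq] using this

lemma abs_pr1 (r₀ a b r r' : E3) :
    |co r₀ b r - co r₀ b r'| ≤ dist (pr r₀ a b r) (pr r₀ a b r') := by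
  have := dist_le_pi_dist (pr r₀ a b r) (pr r₀ a b r') 1
  simpa [pr, Real.dist_eq] using this

lemma dist_pr (r₀ a b r r' : E3) {D : ℝ} (h1 : |co r₀ a r - co r₀ a r'| ≤ D)
    (h2 : |co r₀ b r - co r₀ b r'| ≤ D) : dist (pr r₀ a b r) (pr r₀ a b r') ≤ D := by
  rw [dist_pi_le_iff ((abs_nonneg _).trans h1)]
  intro i
  fin_cases i
  · simpa [pr, Real.dist_eq] using h1
  · simpa [pr, Real.dist_eq] using h2

/-- Graph lemma: a set of boundary points with a uniformly nonzero first normal component has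
area controlled by its projection. -/
lemma piece {e₁ e₂ e₃ u₁ u₂ u₃ : E3} {M : ℝ} (F : DualFrame e₁ e₂ e₃ u₁ u₂ u₃ M)
    {C : Set E3} (r₀ : E3) {A : Set E3} (hAC : A ⊆ C) {σ ε : ℝ} (hε : 0 < ε)
    (hσ : σ = 1 ∨ σ = -1)
    (hA : ∀ r ∈ A, ∃ n, IsOutwardNormalAt C r n ∧ ε ≤ σ * ⟪n, u₁⟫) :
    μH[2] A ≤ ENNReal.ofReal (M * (2 * M / ε + 2)) ^ 2 * volume (pr r₀ e₂ e₃ '' A) := by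
  have hM := F.hM
  have := haus_le (fun r : E3 => r) (pr r₀ e₂ e₃) A (M * (2 * M / ε + 2)) (by positivity) ?_
  · rw [vol2] at this
    simpa using this
  intro r hr r' hr'
  obtain ⟨n, hn, hp⟩ := hA r hr
  obtain ⟨n', hn', hp'⟩ := hA r' hr'
  have h1 := F.slope_pts r₀ (hAC hr) (hAC hr') hn hn' hσ hp hp'
  have h2 := F.norm_le r₀ r r'
  have h3 := abs_pr0 r₀ e₂ e₃ r r'
  have h4 := abs_pr1 r₀ e₂ e₃ r r'
  set D := dist (pr r₀ e₂ e₃ r) (pr r₀ e₂ e₃ r')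
  rw [dist_eq_norm]
  have h5 : |co r₀ e₁ r - co r₀ e₁ r'| ≤ 2 * M / ε * D := by
    rw [div_mul_eq_mul_div, le_div_iff₀ hε]
    refine h1.trans ?_
    nlinarith
  refine h2.trans ?_
  rw [mul_assoc]
  refine mul_le_mul_of_nonneg_left ?_ (by linarith)
  linarith

lemma exists_frame {e₁ e₂ : E3} (he₁ : ‖e₁‖ = 1) (he₂ : ‖e₂‖ = 1) (hne : e₁ ≠ e₂)
    (hne' : e₁ ≠ -e₂) : ∃ (e₃ u₁ u₂ u₃ : E3) (M : ℝ), DualFrame e₁ e₂ e₃ u₁ u₂ u₃ M := by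
  set c : ℝ := ⟪e₁, e₂⟫ with hc
  have hc1 : c ≠ 1 := fun h => hne ((inner_eq_one_iff_of_norm_eq_one he₁ he₂).1 h)
  have hc2 : c ≠ -1 := fun h => hne' ((inner_eq_neg_one_iff_of_norm_eq_one he₁ he₂).1 h)
  have hD : 1 - c ^ 2 ≠ 0 := by
    intro h
    have : (1 - c) * (1 + c) = 0 := by linarith
    rcases mul_eq_zero.1 this with h | h
    · exact hc1 (by linarith)
    · exact hc2 (by linarith)
  have h11 : ⟪e₁, e₁⟫ = (1:ℝ) := by rw [real_inner_self_eq_norm_sq, he₁]; norm_num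
  have h22 : ⟪e₂, e₂⟫ = (1:ℝ) := by rw [real_inner_self_eq_norm_sq, he₂]; norm_num
  have h21 : ⟪e₂, e₁⟫ = c := by rw [real_inner_comm]
  -- the third vector
  obtain ⟨w, hw0, hw⟩ : ∃ w : E3, w ≠ 0 ∧ ∀ v ∈ Submodule.span ℝ {e₁, e₂}, ⟪v, w⟫ = 0 := by
    have hlt : Module.finrank ℝ (Submodule.span ℝ ({e₁, e₂} : Set E3)) < 3 := by
      have h := finrank_span_finset_le_card (R := ℝ) ({e₁, e₂} : Finset E3)
      have h2 : ({e₁, e₂} : Finset E3).card ≤ 2 := Finset.card_le_two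
      simp only [Finset.coe_insert, Finset.coe_singleton] at h
      unfold Set.finrank at h
      omega
    have hfr := Submodule.finrank_add_finrank_orthogonal (Submodule.span ℝ ({e₁, e₂} : Set E3))
    have h3 : Module.finrank ℝ E3 = 3 := by simp
    have hpos : 0 < Module.finrank ℝ (Submodule.span ℝ ({e₁, e₂} : Set E3))ᗮ := by omega
    obtain ⟨w, hw⟩ := (Module.finrank_pos_iff_exists_ne_zero (R := ℝ)).1 hpos
    refine ⟨w, fun h => hw (Subtype.ext h), fun v hv => ?_⟩
    exact (Submodule.mem_orthogonal _ _).1 w.2 v hv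
  have hw1 : ⟪e₁, w⟫ = (0:ℝ) := hw _ (Submodule.subset_span (by simp))
  have hw2 : ⟪e₂, w⟫ = (0:ℝ) := hw _ (Submodule.subset_span (by simp))
  have hww : ⟪w, w⟫ ≠ (0:ℝ) := by simpa using hw0
  have hw1' : ⟪w, e₁⟫ = (0:ℝ) := by rw [real_inner_comm, hw1]
  have hw2' : ⟪w, e₂⟫ = (0:ℝ) := by rw [real_inner_comm, hw2]
  set u₁ : E3 := (-(1 - c ^ 2)⁻¹) • (e₁ - c • e₂) with hu₁
  set u₂ : E3 := (-(1 - c ^ 2)⁻¹) • (e₂ - c • e₁) with hu₂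
  set u₃ : E3 := (-(⟪w, w⟫ : ℝ)⁻¹) • w with hu₃
  have g11 : ⟪u₁, e₁⟫ = (-1:ℝ) := by
    simp only [hu₁, inner_smul_left, inner_sub_left, h11, h21]; simp; field_simp
  have g12 : ⟪u₁, e₂⟫ = (0:ℝ) := by
    simp only [hu₁, inner_smul_left, inner_sub_left, h22, ← hc]; simp
  have g13 : ⟪u₁, w⟫ = (0:ℝ) := by
    simp only [hu₁, inner_smul_left, inner_sub_left, hw1, hw2]; simp
  have g21 : ⟪u₂, e₁⟫ = (0:ℝ) := by
    simp only [hu₂, inner_smul_left, inner_sub_left, h11, h21]; simp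
  have g22 : ⟪u₂, e₂⟫ = (-1:ℝ) := by
    simp only [hu₂, inner_smul_left, inner_sub_left, h22, ← hc]; simp; field_simp
  have g23 : ⟪u₂, w⟫ = (0:ℝ) := by
    simp only [hu₂, inner_smul_left, inner_sub_left, hw1, hw2]; simp
  have g31 : ⟪u₃, e₁⟫ = (0:ℝ) := by simp only [hu₃, inner_smul_left, hw1']; simp
  have g32 : ⟪u₃, e₂⟫ = (0:ℝ) := by simp only [hu₃, inner_smul_left, hw2']; simp
  have g33 : ⟪u₃, w⟫ = (-1:ℝ) := by
    simp only [hu₃, inner_smul_left]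
    simp only [map_neg, map_inv₀, conj_trivial]
    rw [neg_mul, inv_mul_cancel₀ hww]
  have hspan : Submodule.span ℝ (Set.range ![e₁, e₂, w]) = ⊤ := by
    have hli : LinearIndependent ℝ ![e₁, e₂, w] := by
      rw [Fintype.linearIndependent_iff]
      intro g hg
      simp only [Fin.sum_univ_three, Matrix.cons_val_zero, Matrix.cons_val_one,
        Matrix.cons_val] at hg
      have k1 : ⟪u₁, g 0 • e₁ + g 1 • e₂ + g 2 • w⟫ = (0:ℝ) := by rw [hg, inner_zero_right]
      have k2 : ⟪u₂, g 0 • e₁ + g 1 • e₂ + g 2 • w⟫ = (0:ℝ) := by rw [hg, inner_zero_right]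
      have k3 : ⟪u₃, g 0 • e₁ + g 1 • e₂ + g 2 • w⟫ = (0:ℝ) := by rw [hg, inner_zero_right]
      simp only [inner_add_right, inner_smul_right, g11, g12, g13] at k1
      simp only [inner_add_right, inner_smul_right, g21, g22, g23] at k2
      simp only [inner_add_right, inner_smul_right, g31, g32, g33] at k3
      intro i
      fin_cases i
      · show g 0 = 0
        linarith
      · show g 1 = 0
        linarith
      · show g 2 = 0
        linarith
    exact hli.span_eq_top_of_card_eq_finrank' (by simp)
  refine ⟨w, u₁, u₂, u₃, 1 + ‖e₁‖ + ‖e₂‖ + ‖w‖ + ‖u₁‖ + ‖u₂‖ + ‖u₃‖, ?_⟩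
  have n1 := norm_nonneg e₁
  have n2 := norm_nonneg e₂
  have n3 := norm_nonneg w
  have n4 := norm_nonneg u₁
  have n5 := norm_nonneg u₂
  have n6 := norm_nonneg u₃
  refine ⟨fun v => ?_, g11, g12, g13, g21, g22, g23, g31, g32, g33, by linarith, by linarith,
    by linarith, by linarith, by linarith, by linarith, by linarith⟩
  rw [← sub_eq_zero]
  set d := v - ((-⟪v, e₁⟫) • u₁ + (-⟪v, e₂⟫) • u₂ + (-⟪v, w⟫) • u₃) with hd
  have d1 : ⟪d, e₁⟫ = (0:ℝ) := by
    simp only [hd, inner_sub_left, inner_add_left, inner_smul_left, g11, g21, g31]; simp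
  have d2 : ⟪d, e₂⟫ = (0:ℝ) := by
    simp only [hd, inner_sub_left, inner_add_left, inner_smul_left, g12, g22, g32]; simp
  have d3 : ⟪d, w⟫ = (0:ℝ) := by
    simp only [hd, inner_sub_left, inner_add_left, inner_smul_left, g13, g23, g33]; simp
  have hall : ∀ x ∈ Submodule.span ℝ (Set.range ![e₁, e₂, w]), ⟪d, x⟫ = (0:ℝ) := by
    intro x hx
    induction hx using Submodule.span_induction with
    | mem x h =>
      obtain ⟨i, rfl⟩ := h
      fin_cases i
      · exact d1
      · exact d2
      · exact d3
    | zero => simp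
    | add x y _ _ hx hy => rw [inner_add_right, hx, hy, add_zero]
    | smul a x _ hx => rw [inner_smul_right, hx, mul_zero]
  have := hall d (by rw [hspan]; trivial)
  simpa using this

lemma mem_tanCone {C : Set E3} {r₀ r : E3} (hr : r ∈ C) : r - r₀ ∈ tanCone C r₀ :=
  subset_closure ⟨1, r, hr, zero_le_one, by simp⟩

lemma co_nonneg {C : Set E3} {r₀ e₁ e₂ : E3} (hcone : tanCone C r₀ = dihedral e₁ e₂) {r : E3}
    (hr : r ∈ C) : 0 ≤ co r₀ e₁ r ∧ 0 ≤ co r₀ e₂ r := by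
  have h := mem_tanCone (r₀ := r₀) hr
  rw [hcone] at h
  exact ⟨neg_nonneg.2 h.1, neg_nonneg.2 h.2⟩

lemma exists_dir {C : Set E3} {r₀ e₁ e₂ e₃ u₁ u₂ u₃ : E3} {M : ℝ}
    (F : DualFrame e₁ e₂ e₃ u₁ u₂ u₃ M) (hC : IsConvexBody C) (hr₀ : r₀ ∈ C)
    (hcone : tanCone C r₀ = dihedral e₁ e₂) {x y : ℝ} (hx : 0 < x) (hy : 0 < y) (z : ℝ) :
    ∃ s₀ > 0, ∀ s, 0 < s → s ≤ s₀ → pt r₀ u₁ u₂ u₃ (s * x) (s * y) (s * z) ∈ C := by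
  obtain ⟨-, hconv, hintg⟩ := hC
  set K : Set E3 := {v : E3 | ∃ c : ℝ, ∃ r ∈ C, 0 ≤ c ∧ v = c • (r - r₀)} with hK
  have hKconv : Convex ℝ K := by
    rintro _ ⟨c, r, hr, hc, rfl⟩ _ ⟨c', r', hr', hc', rfl⟩ a b ha hb hab
    rcases (add_nonneg (mul_nonneg ha hc) (mul_nonneg hb hc')).eq_or_lt with h0 | hpos
    · have h1 : a * c = 0 := by nlinarith [mul_nonneg ha hc, mul_nonneg hb hc']
      have h2 : b * c' = 0 := by nlinarith [mul_nonneg ha hc, mul_nonneg hb hc']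
      exact ⟨0, r, hr, le_rfl, by simp [smul_smul, h1, h2]⟩
    · set D := a * c + b * c' with hD
      refine ⟨D, (a * c / D) • r + (b * c' / D) • r', ?_, hpos.le, ?_⟩
      · exact hconv hr hr' (by positivity) (by positivity) (by rw [← add_div, ← hD, div_self hpos.ne'])
      · have : D • ((a * c / D) • r + (b * c' / D) • r' - r₀)
            = (a * c) • r + (b * c') • r' - D • r₀ := by
          rw [smul_sub, smul_add, smul_smul, smul_smul, mul_div_cancel₀ _ hpos.ne',
            mul_div_cancel₀ _ hpos.ne']
        rw [this, hD, add_smul, smul_smul, smul_smul, smul_sub, smul_sub]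
        abel
  have hKint : (interior K).Nonempty := by
    obtain ⟨p, hp⟩ := hintg
    refine ⟨p - r₀, ?_⟩
    rw [mem_interior] at hp ⊢
    obtain ⟨U, hU, hUo, hpU⟩ := hp
    refine ⟨(fun v => v + r₀) ⁻¹' U, ?_, hUo.preimage (by fun_prop), by simpa using hpU⟩
    intro v hv
    exact ⟨1, v + r₀, hU hv, zero_le_one, by simp⟩
  have hcl : closure K = dihedral e₁ e₂ := hcone
  set v : E3 := x • u₁ + y • u₂ + z • u₃ with hv
  have hvK : v ∈ interior K := by
    rw [← hKconv.interior_closure_eq_interior_of_nonempty_interior hKint, hcl, mem_interior]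
    refine ⟨{v | ⟪v, e₁⟫ < 0 ∧ ⟪v, e₂⟫ < 0}, fun w hw => ⟨hw.1.le, hw.2.le⟩, ?_, ?_⟩
    · have o1 : IsOpen {v : E3 | ⟪v, e₁⟫ < (0:ℝ)} := isOpen_lt (by fun_prop) continuous_const
      have o2 : IsOpen {v : E3 | ⟪v, e₂⟫ < (0:ℝ)} := isOpen_lt (by fun_prop) continuous_const
      exact o1.inter o2
    · constructor
      · simp only [hv, inner_add_left, inner_smul_left, F.h11, F.h21, F.h31]; simpa using hx
      · simp only [hv, inner_add_left, inner_smul_left, F.h12, F.h22, F.h32]; simpa using hy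
  obtain ⟨c, r, hr, hc, hvc⟩ := interior_subset hvK
  have hc0 : 0 < c := by
    rcases hc.eq_or_lt with h | h
    · exfalso
      have : ⟪v, e₁⟫ = (0:ℝ) := by rw [hvc, ← h]; simp
      simp only [hv, inner_add_left, inner_smul_left, F.h11, F.h21, F.h31] at this
      simp at this
      exact hx.ne' this
    · exact h
  refine ⟨1 / c, by positivity, fun s hs hsc => ?_⟩
  have hsc' : s * c ≤ 1 := by rwa [le_div_iff₀ hc0] at hsc
  have : pt r₀ u₁ u₂ u₃ (s * x) (s * y) (s * z) = (1 - s * c) • r₀ + (s * c) • r := by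
    have : s • v = (s * c) • (r - r₀) := by rw [hvc, smul_smul]
    rw [hv, smul_add, smul_add, smul_smul, smul_smul, smul_smul] at this
    rw [pt, this, sub_smul, one_smul, smul_sub]
    abel
  rw [this]
  exact hconv hr₀ hr (by linarith) (by positivity) (by ring)

/-! measurability of the normal map -/

lemma isClosed_normals (C : Set E3) : IsClosed {q : E3 × E3 | IsOutwardNormalAt C q.1 q.2} := by
  have : {q : E3 × E3 | IsOutwardNormalAt C q.1 q.2} =
      {q : E3 × E3 | ‖q.2‖ = 1} ∩ ⋂ x ∈ C, {q : E3 × E3 | ⟪x - q.1, q.2⟫ ≤ (0:ℝ)} := by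
    ext q
    simp [IsOutwardNormalAt]
  rw [this]
  refine IsClosed.inter (isClosed_eq (by fun_prop) continuous_const) ?_
  exact isClosed_biInter fun x _ => isClosed_le (by fun_prop) continuous_const

lemma isCompact_normal_in {C : Set E3} (hC : IsCompact C) {G : Set E3} (hG : IsClosed G) :
    IsCompact {r ∈ frontier C | ∃ n ∈ G, IsOutwardNormalAt C r n} := by
  have hf : IsCompact (frontier C) := hC.of_isClosed_subset isClosed_frontier hC.isClosed.frontier_subset
  have h1 : IsCompact ((frontier C ×ˢ Metric.sphere (0:E3) 1) ∩
      ({q : E3 × E3 | IsOutwardNormalAt C q.1 q.2} ∩ {q | q.2 ∈ G})) :=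
    (hf.prod (isCompact_sphere _ _)).inter_right
      ((isClosed_normals C).inter (hG.preimage continuous_snd))
  have h2 := h1.image continuous_fst
  convert h2 using 1
  ext r
  constructor
  · rintro ⟨hr, n, hn, hrn⟩
    exact ⟨(r, n), ⟨⟨hr, by simpa using hrn.1⟩, hrn, hn⟩, rfl⟩
  · rintro ⟨⟨r, n⟩, ⟨⟨hr, -⟩, hrn, hn⟩, rfl⟩
    exact ⟨hr, n, hn, hrn⟩

lemma isCompact_two_normals {C : Set E3} (hC : IsCompact C) (δ : ℝ) :
    IsCompact {r ∈ frontier C | ∃ n n', IsOutwardNormalAt C r n ∧ IsOutwardNormalAt C r n' ∧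
      δ ≤ dist n n'} := by
  have hf : IsCompact (frontier C) := hC.of_isClosed_subset isClosed_frontier hC.isClosed.frontier_subset
  have h1 : IsCompact ((frontier C ×ˢ (Metric.sphere (0:E3) 1 ×ˢ Metric.sphere (0:E3) 1)) ∩
      ({q : E3 × E3 × E3 | IsOutwardNormalAt C q.1 q.2.1} ∩
        {q : E3 × E3 × E3 | IsOutwardNormalAt C q.1 q.2.2} ∩
        {q : E3 × E3 × E3 | δ ≤ dist q.2.1 q.2.2})) := by
    refine (hf.prod ((isCompact_sphere _ _).prod (isCompact_sphere _ _))).inter_right ?_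
    refine IsClosed.inter (IsClosed.inter ?_ ?_) (isClosed_le continuous_const (by fun_prop))
    · exact (isClosed_normals C).preimage (f := fun q : E3 × E3 × E3 => (q.1, q.2.1)) (by fun_prop)
    · exact (isClosed_normals C).preimage (f := fun q : E3 × E3 × E3 => (q.1, q.2.2)) (by fun_prop)
  have h2 := h1.image continuous_fst
  convert h2 using 1
  ext r
  constructor
  · rintro ⟨hr, n, n', hn, hn', hd⟩
    exact ⟨(r, n, n'), ⟨⟨hr, by simpa using hn.1, by simpa using hn'.1⟩, ⟨hn, hn'⟩, hd⟩, rfl⟩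
  · rintro ⟨⟨r, n, n'⟩, ⟨⟨hr, -, -⟩, ⟨hn, hn'⟩, hd⟩, rfl⟩
    exact ⟨hr, n, n', hn, hn', hd⟩

lemma measurableSet_reg {C : Set E3} (hC : IsCompact C) :
    MeasurableSet (frontier C ∩ {r : E3 | IsRegularPt C r}) := by
  have : frontier C ∩ {r : E3 | IsRegularPt C r} =
      {r ∈ frontier C | ∃ n ∈ (univ : Set E3), IsOutwardNormalAt C r n} \
      ⋃ k : ℕ, {r ∈ frontier C | ∃ n n', IsOutwardNormalAt C r n ∧ IsOutwardNormalAt C r n' ∧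
      1 / ((k : ℝ) + 1) ≤ dist n n'} := by
    ext r
    constructor
    · rintro ⟨hr, n, hn, huniq⟩
      refine ⟨⟨hr, n, trivial, hn⟩, ?_⟩
      simp only [mem_iUnion, not_exists]
      rintro k ⟨-, m, m', hm, hm', hd⟩
      rw [huniq m hm, huniq m' hm', dist_self] at hd
      have : (0:ℝ) < 1 / ((k : ℝ) + 1) := by positivity
      linarith
    · rintro ⟨⟨hr, n, -, hn⟩, hU⟩
      refine ⟨hr, n, hn, fun m hm => ?_⟩
      by_contra hne
      have hd : 0 < dist m n := dist_pos.2 hne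
      obtain ⟨k, hk⟩ := exists_nat_one_div_lt hd
      exact hU (mem_iUnion.2 ⟨k, hr, m, n, hm, hn, hk.le⟩)
  rw [this]
  refine MeasurableSet.diff (isCompact_normal_in hC isClosed_univ).measurableSet ?_
  exact MeasurableSet.iUnion fun k => (isCompact_two_normals hC _).measurableSet

lemma normalMap_spec {C : Set E3} {r : E3} (h : IsRegularPt C r) :
    IsOutwardNormalAt C r (normalMap C r) := by
  have h' : ∃ n : E3, IsOutwardNormalAt C r n := h.exists
  rw [normalMap, dif_pos h']
  exact h'.choose_spec

lemma measurableSet_sreg {C : Set E3} (hC : IsCompact C) (r₀ e : E3) (t : ℝ) :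
    MeasurableSet (Sset C r₀ e t ∩ {r : E3 | IsRegularPt C r}) := by
  have : Sset C r₀ e t ∩ {r : E3 | IsRegularPt C r} =
      (frontier C ∩ {r : E3 | IsRegularPt C r}) ∩ {r : E3 | ⟪r - r₀, e⟫ ≥ -t} := by
    ext r; simp only [Sset, mem_inter_iff, mem_ofPred_eq]; tauto
  rw [this]
  exact (measurableSet_reg hC).inter (isClosed_le continuous_const (by fun_prop)).measurableSet

lemma aemeasurable_normalMap {C : Set E3} (hC : IsCompact C) (r₀ e : E3) (t : ℝ) :
    AEMeasurable (normalMap C)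
      (μH[2].restrict (Sset C r₀ e t ∩ {r : E3 | IsRegularPt C r})) := by
  refine aemeasurable_restrict_of_measurable_subtype (measurableSet_sreg hC r₀ e t) ?_
  refine measurable_of_isClosed fun G hG => ?_
  have : (fun x : ↥(Sset C r₀ e t ∩ {r : E3 | IsRegularPt C r}) => normalMap C x) ⁻¹' G =
      Subtype.val ⁻¹' {r ∈ frontier C | ∃ n ∈ G, IsOutwardNormalAt C r n} := by
    ext ⟨r, hr⟩
    constructor
    · intro h
      exact ⟨hr.1.1, _, h, normalMap_spec hr.2⟩
    · rintro ⟨-, n, hn, hrn⟩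
      have : normalMap C r = n := hr.2.unique (normalMap_spec hr.2) hrn
      simpa [this] using hn
  rw [this]
  exact measurable_subtype_coe (isCompact_normal_in hC hG).measurableSet

/-- the standing configuration -/
structure Cfg (C : Set E3) (r₀ e₁ e₂ e₃ u₁ u₂ u₃ : E3) (M lam₁ lam₂ : ℝ) : Prop where
  F : DualFrame e₁ e₂ e₃ u₁ u₂ u₃ M
  hC : IsConvexBody C
  hr₀ : r₀ ∈ C
  hcone : tanCone C r₀ = dihedral e₁ e₂
  hl₁ : 0 < lam₁
  hl₂ : 0 < lam₂

section cfg
variable {C : Set E3} {r₀ e₁ e₂ e₃ u₁ u₂ u₃ : E3} {M lam₁ lam₂ : ℝ}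

lemma Cfg.swap (G : Cfg C r₀ e₁ e₂ e₃ u₁ u₂ u₃ M lam₁ lam₂) :
    Cfg C r₀ e₂ e₁ e₃ u₂ u₁ u₃ M lam₂ lam₁ where
  F := G.F.swap
  hC := G.hC
  hr₀ := G.hr₀
  hcone := by rw [G.hcone]; ext v; exact and_comm
  hl₁ := G.hl₂
  hl₂ := G.hl₁

lemma Cfg.bound1 (G : Cfg C r₀ e₁ e₂ e₃ u₁ u₂ u₃ M lam₁ lam₂) {r : E3} (hr : r ∈ C) {t : ℝ}
    (ht : lam₁ * co r₀ e₁ r + lam₂ * co r₀ e₂ r ≤ t) :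
    0 ≤ co r₀ e₁ r ∧ co r₀ e₁ r ≤ (1 / lam₁ + 1 / lam₂) * t := by
  have h := co_nonneg G.hcone hr
  have h1 := G.hl₁
  have h2 := G.hl₂
  have h3 := mul_nonneg h1.le h.1
  have h4 := mul_nonneg h2.le h.2
  refine ⟨h.1, ?_⟩
  have h5 : co r₀ e₁ r ≤ 1 / lam₁ * t := by
    rw [div_mul_eq_mul_div, le_div_iff₀ h1]; linarith
  have h6 : 0 ≤ 1 / lam₂ * t := mul_nonneg (by positivity) (by linarith)
  linarith

lemma Cfg.bound2 (G : Cfg C r₀ e₁ e₂ e₃ u₁ u₂ u₃ M lam₁ lam₂) {r : E3} (hr : r ∈ C) {t : ℝ}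
    (ht : lam₁ * co r₀ e₁ r + lam₂ * co r₀ e₂ r ≤ t) :
    0 ≤ co r₀ e₂ r ∧ co r₀ e₂ r ≤ (1 / lam₁ + 1 / lam₂) * t := by
  rw [add_comm (1 / lam₁)]
  exact G.swap.bound1 hr (by linarith)

lemma key_claim (G : Cfg C r₀ e₁ e₂ e₃ u₁ u₂ u₃ M lam₁ lam₂) {ε : ℝ} (hε : 0 < ε) (K : ℝ) :
    ∃ t₀ > 0, ∀ t, 0 < t → t ≤ t₀ → ∀ r ∈ C, lam₁ * co r₀ e₁ r + lam₂ * co r₀ e₂ r ≤ t →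
      ∀ n, IsOutwardNormalAt C r n → ε ≤ ⟪n, u₁⟫ → K * t ≤ |⟪n, u₃⟫| * |co r₀ e₃ r| := by
  have hl₁ := G.hl₁
  have hl₂ := G.hl₂
  have hM := G.F.hM
  set H := 1 / lam₁ + 1 / lam₂ with hH
  have hH0 : 0 < H := by positivity
  set X := (|K| + 2 * M * H + M) / ε with hX
  have hX0 : 0 < X := by positivity
  obtain ⟨s₀, hs₀, hs⟩ := exists_dir G.F G.hC G.hr₀ G.hcone hX0 one_pos 0
  refine ⟨s₀, hs₀, fun t ht hts r hr hrt n hn hp => ?_⟩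
  have h1 := hn.2 _ (hs t ht hts)
  rw [G.F.inner_eq r₀, G.F.co1, G.F.co2, G.F.co3] at h1
  have b1 := G.bound1 hr hrt
  have b2 := G.bound2 hr hrt
  rw [← hH] at b1 b2
  have p1 := abs_le.1 (abs_inner_le_M hn.1 G.F.nu1)
  have p2 := abs_le.1 (abs_inner_le_M hn.1 G.F.nu2)
  have p3 : |⟪n, u₃⟫ * co r₀ e₃ r| = |⟪n, u₃⟫| * |co r₀ e₃ r| := abs_mul _ _
  have p3' := le_abs_self (⟪n, u₃⟫ * co r₀ e₃ r)
  have hXε : X * ε = |K| + 2 * M * H + M := by rw [hX]; field_simp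
  have q1 : X * ε * t ≤ X * ⟪n, u₁⟫ * t := by gcongr
  have q2 : co r₀ e₁ r * ⟪n, u₁⟫ ≤ H * t * M := by
    have : 0 ≤ ⟪n, u₁⟫ := hε.le.trans hp
    exact mul_le_mul b1.2 p1.2 this (by positivity)
  have q3 : -(t * M) ≤ t * ⟪n, u₂⟫ := by nlinarith
  have q4 : co r₀ e₂ r * ⟪n, u₂⟫ ≤ H * t * M := by
    calc co r₀ e₂ r * ⟪n, u₂⟫ ≤ co r₀ e₂ r * M := mul_le_mul_of_nonneg_left p2.2 b2.1
      _ ≤ _ := mul_le_mul_of_nonneg_right b2.2 (by linarith)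
  rw [hXε] at q1
  have q5 : K * t ≤ |K| * t := mul_le_mul_of_nonneg_right (le_abs_self K) ht.le
  nlinarith

lemma vol_box (a b : ℝ) (S : Set (Fin 2 → ℝ)) (hS : ∀ w ∈ S, (0 ≤ w 0 ∧ w 0 ≤ a) ∧ (0 ≤ w 1 ∧ w 1 ≤ b)) :
    volume S ≤ ENNReal.ofReal a * ENNReal.ofReal b := by
  have : S ⊆ Icc 0 ![a, b] := by
    intro w hw
    have := hS w hw
    constructor
    · intro i; fin_cases i
      · exact this.1.1
      · exact this.2.1
    · intro i; fin_cases i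
      · exact this.1.2
      · exact this.2.2
  refine (measure_mono this).trans ?_
  rw [Real.volume_Icc_pi]
  simp

lemma pr_box {A : Set E3} {a : ℝ} {e₁ e₂ : E3}
    (hA : ∀ r ∈ A, (0 ≤ co r₀ e₁ r ∧ co r₀ e₁ r ≤ a) ∧ (0 ≤ co r₀ e₂ r ∧ co r₀ e₂ r ≤ a)) :
    volume (pr r₀ e₁ e₂ '' A) ≤ ENNReal.ofReal a ^ 2 := by
  rw [sq]
  refine vol_box a a _ ?_
  rintro _ ⟨r, hr, rfl⟩
  exact hA r hr

lemma bad3 (F : DualFrame e₁ e₂ e₃ u₁ u₂ u₃ M) {A : Set E3} (hAC : A ⊆ C) {a ε σ : ℝ}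
    (hA : ∀ r ∈ A, (0 ≤ co r₀ e₁ r ∧ co r₀ e₁ r ≤ a) ∧ (0 ≤ co r₀ e₂ r ∧ co r₀ e₂ r ≤ a))
    (hε : 0 < ε) (hσ : σ = 1 ∨ σ = -1)
    (hn : ∀ r ∈ A, ∃ n, IsOutwardNormalAt C r n ∧ ε ≤ σ * ⟪n, u₃⟫) :
    μH[2] A ≤ ENNReal.ofReal (M * (2 * M / ε + 2)) ^ 2 * ENNReal.ofReal a ^ 2 :=
  (piece F.rot r₀ hAC hε hσ hn).trans (mul_le_mul_right (pr_box hA) _)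

lemma bad1 (F : DualFrame e₁ e₂ e₃ u₁ u₂ u₃ M) {A : Set E3} (hAC : A ⊆ C) {a ε η σ : ℝ}
    (hA : ∀ r ∈ A, (0 ≤ co r₀ e₁ r ∧ co r₀ e₁ r ≤ a) ∧ (0 ≤ co r₀ e₂ r ∧ co r₀ e₂ r ≤ a))
    (hε : 0 < ε) (hη : 0 < η) (hσ : σ = 1 ∨ σ = -1)
    (hn : ∀ r ∈ A, ∃ n, IsOutwardNormalAt C r n ∧ ε ≤ ⟪n, u₁⟫ ∧ η ≤ σ * ⟪n, u₃⟫) :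
    μH[2] A ≤ ENNReal.ofReal (M * (2 * M / ε + 2)) ^ 2 *
      (ENNReal.ofReal (2 * M) ^ 2 * ENNReal.ofReal a ^ 2 * (ENNReal.ofReal η)⁻¹) := by
  have hM := F.hM
  refine (piece F r₀ hAC hε (Or.inl rfl) (σ := 1) ?_).trans (mul_le_mul_right ?_ _)
  · intro r hr
    obtain ⟨n, h1, h2, -⟩ := hn r hr
    exact ⟨n, h1, by linarith⟩
  have hη' : ENNReal.ofReal η ≠ 0 := by simpa using hη
  rw [← div_eq_mul_inv, ENNReal.le_div_iff_mul_le (Or.inl hη') (Or.inl ENNReal.ofReal_ne_top)]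
  set D : Matrix (Fin 2) (Fin 2) ℝ := !![1, 0; 0, η] with hD
  have hdet : LinearMap.det (Matrix.toLin' D) = η := by
    rw [LinearMap.det_toLin', hD, Matrix.det_fin_two_of]; ring
  have hvol := Measure.addHaar_image_linearMap volume (Matrix.toLin' D) (pr r₀ e₂ e₃ '' A)
  rw [hdet, abs_of_pos hη, ← image_comp] at hvol
  rw [mul_comm, ← hvol]
  have hcomp : ∀ r i, (Matrix.toLin' D ∘ pr r₀ e₂ e₃) r i = ![co r₀ e₂ r, η * co r₀ e₃ r] i := by
    intro r i
    fin_cases i <;> simp [hD, pr, Matrix.vecHead, Matrix.vecTail, mul_comm]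
  have := haus_le (Matrix.toLin' D ∘ pr r₀ e₂ e₃) (pr r₀ e₁ e₂) A (2 * M) (by linarith) ?_
  · rw [vol2] at this
    exact this.trans (mul_le_mul_right (pr_box hA) _)
  intro r hr r' hr'
  obtain ⟨n, h1, -, h2⟩ := hn r hr
  obtain ⟨n', h1', -, h2'⟩ := hn r' hr'
  have h3 := F.rot.slope_pts r₀ (hAC hr) (hAC hr') h1 h1' hσ h2 h2'
  have h4 := abs_pr0 r₀ e₁ e₂ r r'
  have h5 := abs_pr1 r₀ e₁ e₂ r r'
  have h0 : 0 ≤ dist (pr r₀ e₁ e₂ r) (pr r₀ e₁ e₂ r') := dist_nonneg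
  set Δ := dist (pr r₀ e₁ e₂ r) (pr r₀ e₁ e₂ r')
  rw [dist_pi_le_iff (by positivity)]
  intro i
  rw [hcomp, hcomp]
  fin_cases i
  · simp only [Fin.zero_eta, Matrix.cons_val_zero, Real.dist_eq]
    nlinarith
  · simp only [Fin.mk_one, Matrix.cons_val_one, Matrix.cons_val_zero, Real.dist_eq]
    rw [← mul_sub, abs_mul, abs_of_pos hη]
    nlinarith

lemma co_combo (a r r' : E3) {s s' : ℝ} (h : s + s' = 1) :
    co r₀ a (s • r + s' • r') = s * co r₀ a r + s' * co r₀ a r' := by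
  have : s • r + s' • r' - r₀ = s • (r - r₀) + s' • (r' - r₀) := by
    have : r₀ = (s + s') • r₀ := by rw [h, one_smul]
    conv_lhs => rw [this]
    rw [add_smul, smul_sub, smul_sub]; abel
  simp only [co, this, inner_add_left, inner_smul_left]
  simp; ring

lemma abs_co_sub_le (a r r' : E3) : |co r₀ a r - co r₀ a r'| ≤ ‖a‖ * dist r r' := by
  have : co r₀ a r - co r₀ a r' = -⟪r - r', a⟫ := by
    simp only [co, inner_sub_left]; ring
  rw [this, abs_neg, dist_eq_norm, mul_comm]
  exact abs_real_inner_le_norm _ _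

lemma vol_pr_le {a b : E3} {M : ℝ} (hM : 0 ≤ M) (ha : ‖a‖ ≤ M) (hb : ‖b‖ ≤ M) (A : Set E3) :
    volume (pr r₀ a b '' A) ≤ ENNReal.ofReal M ^ 2 * μH[2] A := by
  have := haus_le (pr r₀ a b) (fun r : E3 => r) A M hM ?_
  · rw [vol2] at this
    simpa using this
  intro r _ r' _
  refine dist_pr _ _ _ _ _ ?_ ?_
  · exact (abs_co_sub_le a r r').trans (mul_le_mul_of_nonneg_right ha dist_nonneg)
  · exact (abs_co_sub_le b r r').trans (mul_le_mul_of_nonneg_right hb dist_nonneg)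

/-- the slice `h = t` -/
def slice (C : Set E3) (r₀ e₁ e₂ : E3) (lam₁ lam₂ t : ℝ) : Set E3 :=
  {r ∈ C | lam₁ * co r₀ e₁ r + lam₂ * co r₀ e₂ r = t}

lemma vol_triangle (S : Set (Fin 2 → ℝ)) (hS : Convex ℝ S) {a b c : Fin 2 → ℝ} (ha : a ∈ S)
    (hb : b ∈ S) (hc : c ∈ S) :
    ENNReal.ofReal (|(b 0 - a 0) * (c 1 - a 1) - (c 0 - a 0) * (b 1 - a 1)| / 4) ≤ volume S := by
  set D : Matrix (Fin 2) (Fin 2) ℝ := !![b 0 - a 0, c 0 - a 0; b 1 - a 1, c 1 - a 1] with hD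
  have hdet : LinearMap.det (Matrix.toLin' D) =
      (b 0 - a 0) * (c 1 - a 1) - (c 0 - a 0) * (b 1 - a 1) := by
    rw [LinearMap.det_toLin', hD, Matrix.det_fin_two_of]
  have hvol := Measure.addHaar_image_linearMap volume (Matrix.toLin' D)
    (Icc (0 : Fin 2 → ℝ) (fun _ => 1 / 2))
  have hI : volume (Icc (0 : Fin 2 → ℝ) (fun _ => 1 / 2)) = ENNReal.ofReal (1 / 4) := by
    rw [Real.volume_Icc_pi]
    simp only [Fin.prod_univ_two, Pi.zero_apply, sub_zero]
    rw [← ENNReal.ofReal_mul (by norm_num)]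
    norm_num
  rw [hdet, hI, ← ENNReal.ofReal_mul (abs_nonneg _)] at hvol
  rw [div_eq_mul_one_div, ← hvol, ← measure_preimage_add volume a S]
  refine measure_mono ?_
  rintro _ ⟨w, ⟨hw0, hw1⟩, rfl⟩
  have k0 := hw0 0
  have k1 := hw0 1
  have k2 := hw1 0
  have k3 := hw1 1
  simp only [Pi.zero_apply] at k0 k1
  have : a + Matrix.toLin' D w = (1 - w 0 - w 1) • a + w 0 • b + w 1 • c := by
    ext i
    fin_cases i <;> simp [hD, dotProduct, Fin.sum_univ_two] <;> ring
  show a + Matrix.toLin' D w ∈ S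
  rw [this]
  have h3 := hS.sum_mem (t := Finset.univ) (w := ![1 - w 0 - w 1, w 0, w 1]) (z := ![a, b, c])
    (by intro i _
        fin_cases i
        · show 0 ≤ 1 - w 0 - w 1
          linarith
        · exact k0
        · exact k1)
    (by simp [Fin.sum_univ_three]; ring)
    (by intro i _
        fin_cases i
        · exact ha
        · exact hb
        · exact hc)
  simpa [Fin.sum_univ_three] using h3

end cfg

section cfg
variable {C : Set E3} {r₀ e₁ e₂ e₃ u₁ u₂ u₃ : E3} {M lam₁ lam₂ : ℝ}

lemma convex_slice (hC : Convex ℝ C) (t : ℝ) : Convex ℝ (slice C r₀ e₁ e₂ lam₁ lam₂ t) := by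
  rintro r ⟨hr, h⟩ r' ⟨hr', h'⟩ a b ha hb hab
  refine ⟨hC hr hr' ha hb hab, ?_⟩
  rw [co_combo _ _ _ hab, co_combo _ _ _ hab]
  calc _ = a * (lam₁ * co r₀ e₁ r + lam₂ * co r₀ e₂ r) +
        b * (lam₁ * co r₀ e₁ r' + lam₂ * co r₀ e₂ r') := by ring
    _ = (a + b) * t := by rw [h, h']; ring
    _ = t := by rw [hab, one_mul]

lemma convex_pr_image {A : Set E3} (hA : Convex ℝ A) (a b : E3) : Convex ℝ (pr r₀ a b '' A) := by
  rintro _ ⟨r, hr, rfl⟩ _ ⟨r', hr', rfl⟩ s s' hs hs' hss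
  refine ⟨s • r + s' • r', hA hr hr' hs hs' hss, ?_⟩
  ext i
  fin_cases i <;> simp [pr, co_combo _ _ _ hss]

lemma lowB (G : Cfg C r₀ e₁ e₂ e₃ u₁ u₂ u₃ M lam₁ lam₂) :
    ∃ c > 0, ∃ t₀ > 0, ∀ t, 0 < t → t ≤ t₀ → ∀ r ∈ C,
      lam₁ * co r₀ e₁ r + lam₂ * co r₀ e₂ r ≤ t →
      ENNReal.ofReal (c * t * |co r₀ e₃ r|) ≤ μH[2] (slice C r₀ e₁ e₂ lam₁ lam₂ t) := by
  have hl₁ := G.hl₁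
  have hl₂ := G.hl₂
  have hM := G.F.hM
  obtain ⟨s₁, hs₁, h₁⟩ := exists_dir G.F G.hC G.hr₀ G.hcone (x := 3 / (4 * lam₁))
    (y := 1 / (4 * lam₂)) (by positivity) (by positivity) 0
  obtain ⟨s₂, hs₂, h₂⟩ := exists_dir G.F G.hC G.hr₀ G.hcone (x := 1 / (4 * lam₁))
    (y := 3 / (4 * lam₂)) (by positivity) (by positivity) 0
  obtain ⟨s₃, hs₃, h₃⟩ := exists_dir G.F G.hC G.hr₀ G.hcone (x := 1 / lam₁)
    (y := 1 / lam₂) (by positivity) (by positivity) 0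
  refine ⟨1 / (16 * lam₁ * M ^ 2), by positivity, min s₁ (min s₂ s₃), by positivity, ?_⟩
  intro t ht hts r hr hrt
  have t1 : t ≤ s₁ := hts.trans (min_le_left _ _)
  have t2 : t ≤ s₂ := hts.trans ((min_le_right _ _).trans (min_le_left _ _))
  have t3 : t ≤ s₃ := hts.trans ((min_le_right _ _).trans (min_le_right _ _))
  specialize h₁ t ht t1
  specialize h₂ t ht t2
  specialize h₃ t ht t3
  set b₁ := pt r₀ u₁ u₂ u₃ (t * (3 / (4 * lam₁))) (t * (1 / (4 * lam₂))) (t * 0) with hb₁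
  set b₂ := pt r₀ u₁ u₂ u₃ (t * (1 / (4 * lam₁))) (t * (3 / (4 * lam₂))) (t * 0) with hb₂
  set d := pt r₀ u₁ u₂ u₃ (t * (1 / lam₁)) (t * (1 / lam₂)) (t * 0) with hd
  set B := slice C r₀ e₁ e₂ lam₁ lam₂ t with hB
  have hb₁B : b₁ ∈ B := by
    refine ⟨h₁, ?_⟩
    rw [hb₁, G.F.co1, G.F.co2]; field_simp; ring
  have hb₂B : b₂ ∈ B := by
    refine ⟨h₂, ?_⟩
    rw [hb₂, G.F.co1, G.F.co2]; field_simp; ring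
  set hh := lam₁ * co r₀ e₁ r + lam₂ * co r₀ e₂ r with hhh
  have hh0 : 0 ≤ hh := by
    have := co_nonneg G.hcone hr
    have k1 := mul_nonneg hl₁.le this.1
    have k2 := mul_nonneg hl₂.le this.2
    linarith
  have hpos : 0 < 2 * t - hh := by linarith
  set θ := (t - hh) / (2 * t - hh) with hθ
  have hθ0 : 0 ≤ θ := div_nonneg (by linarith) hpos.le
  have hθ1 : θ ≤ 1 / 2 := by rw [hθ, div_le_iff₀ hpos]; linarith
  have hθe : θ * (2 * t - hh) = t - hh := div_mul_cancel₀ _ hpos.ne'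
  have hsum : (1 - θ) + θ = 1 := by ring
  set b₃ := (1 - θ) • r + θ • d with hb₃
  have hb₃B : b₃ ∈ B := by
    refine ⟨G.hC.2.1 hr h₃ (by linarith) hθ0 hsum, ?_⟩
    rw [hb₃, co_combo _ _ _ hsum, co_combo _ _ _ hsum]
    have : lam₁ * co r₀ e₁ d + lam₂ * co r₀ e₂ d = 2 * t := by
      rw [hd, G.F.co1, G.F.co2]; field_simp; ring
    calc _ = (1 - θ) * hh + θ * (lam₁ * co r₀ e₁ d + lam₂ * co r₀ e₂ d) := by rw [hhh]; ring
      _ = hh + θ * (2 * t - hh) := by rw [this]; ring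
      _ = t := by rw [hθe]; ring
  have hb₃z : co r₀ e₃ b₃ = (1 - θ) * co r₀ e₃ r := by
    rw [hb₃, co_combo _ _ _ hsum, hd, G.F.co3]; ring
  have htri := vol_triangle (pr r₀ e₁ e₃ '' B) (convex_pr_image (convex_slice G.hC.2.1 t) _ _)
    (mem_image_of_mem _ hb₁B) (mem_image_of_mem _ hb₂B) (mem_image_of_mem _ hb₃B)
  have hle := vol_pr_le (r₀ := r₀) (by linarith) G.F.ne1 G.F.ne3 B
  have hz1 : co r₀ e₃ b₁ = 0 := by rw [hb₁, G.F.co3]; ring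
  have hz2 : co r₀ e₃ b₂ = 0 := by rw [hb₂, G.F.co3]; ring
  have hx1 : co r₀ e₁ b₁ = t * (3 / (4 * lam₁)) := by rw [hb₁, G.F.co1]
  have hx2 : co r₀ e₁ b₂ = t * (1 / (4 * lam₁)) := by rw [hb₂, G.F.co1]
  have e0 : ∀ r, pr r₀ e₁ e₃ r 0 = co r₀ e₁ r := fun _ => rfl
  have e1 : ∀ r, pr r₀ e₁ e₃ r 1 = co r₀ e₃ r := fun _ => rfl
  rw [e0, e0, e0, e1, e1, e1, hz1, hz2, hx1, hx2, hb₃z] at htri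
  have h4 := htri.trans hle
  have hval : M ^ 2 * (1 / (16 * lam₁ * M ^ 2) * t * |co r₀ e₃ r|) ≤
      |(t * (1 / (4 * lam₁)) - t * (3 / (4 * lam₁))) * ((1 - θ) * co r₀ e₃ r - 0) -
        (co r₀ e₁ b₃ - t * (3 / (4 * lam₁))) * (0 - 0)| / 4 := by
    have : (t * (1 / (4 * lam₁)) - t * (3 / (4 * lam₁))) * ((1 - θ) * co r₀ e₃ r - 0) -
        (co r₀ e₁ b₃ - t * (3 / (4 * lam₁))) * (0 - 0) =
        -(t / (2 * lam₁) * (1 - θ) * co r₀ e₃ r) := by field_simp; ring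
    rw [this, abs_neg, abs_mul, abs_of_nonneg (mul_nonneg (by positivity : (0:ℝ) ≤ t / (2 * lam₁))
      (by linarith : (0:ℝ) ≤ 1 - θ))]
    have h5 : t / (4 * lam₁) ≤ t / (2 * lam₁) * (1 - θ) := by
      have : t / (4 * lam₁) = t / (2 * lam₁) * (1 / 2) := by field_simp; ring
      rw [this]
      exact mul_le_mul_of_nonneg_left (by linarith) (by positivity)
    have h6 := mul_le_mul_of_nonneg_right h5 (abs_nonneg (co r₀ e₃ r))
    have : M ^ 2 * (1 / (16 * lam₁ * M ^ 2) * t * |co r₀ e₃ r|) =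
      t / (4 * lam₁) * |co r₀ e₃ r| / 4 := by field_simp; ring
    rw [this]
    linarith
  have h7 := (ENNReal.ofReal_le_ofReal hval).trans h4
  rw [ENNReal.ofReal_mul (by positivity), ENNReal.ofReal_pow (by linarith)] at h7
  exact (ENNReal.mul_le_mul_iff_right (by simp; linarith) (by simp)).1 h7

lemma exists_L (G : Cfg C r₀ e₁ e₂ e₃ u₁ u₂ u₃ M lam₁ lam₂) {t : ℝ} (ht : 0 < t) :
    ∃ r ∈ C, lam₁ * co r₀ e₁ r + lam₂ * co r₀ e₂ r ≤ t ∧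
      ∀ r' ∈ C, lam₁ * co r₀ e₁ r' + lam₂ * co r₀ e₂ r' ≤ t → |co r₀ e₃ r'| ≤ |co r₀ e₃ r| := by
  have hcont : ∀ a, Continuous (co r₀ a) := fun a => by unfold co; fun_prop
  have hcomp : IsCompact (C ∩ {r | lam₁ * co r₀ e₁ r + lam₂ * co r₀ e₂ r ≤ t}) := by
    refine G.hC.1.inter_right (isClosed_le ?_ continuous_const)
    exact (continuous_const.mul (hcont _)).add (continuous_const.mul (hcont _))
  obtain ⟨r, hr, hmax⟩ := hcomp.exists_isMaxOn ⟨r₀, G.hr₀, by simp [co, ht.le]⟩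
    ((hcont e₃).abs.continuousOn)
  exact ⟨r, hr.1, hr.2, fun r' hr' h' => hmax ⟨hr', h'⟩⟩

/-- points of the cap with a normal far from the arc -/
def badSet (C : Set E3) (r₀ e₁ e₂ u₁ u₂ u₃ : E3) (lam₁ lam₂ ε t : ℝ) : Set E3 :=
  {r ∈ C | lam₁ * co r₀ e₁ r + lam₂ * co r₀ e₂ r ≤ t ∧ ∃ n, IsOutwardNormalAt C r n ∧
    (ε ≤ ⟪n, u₁⟫ ∨ ε ≤ ⟪n, u₂⟫ ∨ ε ≤ |⟪n, u₃⟫|)}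

lemma bad_small (G : Cfg C r₀ e₁ e₂ e₃ u₁ u₂ u₃ M lam₁ lam₂) {ε δ : ℝ} (hε : 0 < ε)
    (hδ : 0 < δ) : ∃ t₀ > 0, ∀ t, 0 < t → t ≤ t₀ →
      μH[2] (slice C r₀ e₁ e₂ lam₁ lam₂ t) ≠ 0 ∧
      μH[2] (badSet C r₀ e₁ e₂ u₁ u₂ u₃ lam₁ lam₂ ε t) ≤
        ENNReal.ofReal δ * μH[2] (slice C r₀ e₁ e₂ lam₁ lam₂ t) := by
  have hl₁ := G.hl₁
  have hl₂ := G.hl₂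
  have hM := G.F.hM
  obtain ⟨c, hc, tB, htB, hB⟩ := lowB G
  set H := 1 / lam₁ + 1 / lam₂ with hH
  have hH0 : 0 < H := by positivity
  set Q := M * (2 * M / ε + 2) with hQ
  have hQ0 : 0 < Q := by positivity
  set C1 := 2 * Q ^ 2 * H ^ 2 + 4 * (Q ^ 2 * ((2 * M) ^ 2 * H ^ 2)) with hC1
  have hC10 : 0 < C1 := by positivity
  set K := C1 / (c * δ) with hK
  have hK0 : 0 < K := by positivity
  obtain ⟨t1, ht1, hk1⟩ := key_claim G hε K
  obtain ⟨t2, ht2, hk2⟩ := key_claim G.swap hε K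
  obtain ⟨t3, ht3, hk3⟩ := exists_dir G.F G.hC G.hr₀ G.hcone (x := 1 / (2 * lam₁))
    (y := 1 / (2 * lam₂)) (by positivity) (by positivity) K
  refine ⟨min tB (min t1 (min t2 t3)), by positivity, fun t ht hts => ?_⟩
  have k0 : t ≤ tB := hts.trans (min_le_left _ _)
  have k1 : t ≤ t1 := hts.trans ((min_le_right _ _).trans (min_le_left _ _))
  have k2 : t ≤ t2 := hts.trans ((min_le_right _ _).trans
    ((min_le_right _ _).trans (min_le_left _ _)))
  have k3 : t ≤ t3 := hts.trans ((min_le_right _ _).trans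
    ((min_le_right _ _).trans (min_le_right _ _)))
  obtain ⟨rs, hrs, hrst, hmax⟩ := exists_L G ht
  set L := |co r₀ e₃ rs| with hL
  have hLK : K * t ≤ L := by
    have := hmax _ (hk3 t ht k3) (by
      rw [G.F.co1, G.F.co2]
      apply le_of_eq
      field_simp; ring)
    rw [G.F.co3] at this
    have h := le_abs_self (t * K)
    linarith
  have hL0 : 0 < L := lt_of_lt_of_le (by positivity) hLK
  have hBt := hB t ht k0 rs hrs hrst
  rw [← hL] at hBt
  refine ⟨fun h0 => ?_, ?_⟩
  · rw [h0, nonpos_iff_eq_zero, ENNReal.ofReal_eq_zero] at hBt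
    have : 0 < c * t * L := by positivity
    linarith
  set η := K * t / L with hη
  have hη0 : 0 < η := by positivity
  have hηle : ∀ m z : ℝ, K * t ≤ |m| * |z| → |z| ≤ L → η ≤ |m| := by
    intro m z h1 h2
    rw [hη, div_le_iff₀ hL0]
    exact h1.trans (mul_le_mul_of_nonneg_left h2 (abs_nonneg _))
  -- the pieces
  let cap : Set E3 := {r ∈ C | lam₁ * co r₀ e₁ r + lam₂ * co r₀ e₂ r ≤ t}
  let A3 : ℝ → Set E3 := fun σ => {r ∈ cap | ∃ n, IsOutwardNormalAt C r n ∧ ε ≤ σ * ⟪n, u₃⟫}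
  let A1 : ℝ → Set E3 := fun σ => {r ∈ cap | ∃ n, IsOutwardNormalAt C r n ∧ ε ≤ ⟪n, u₁⟫ ∧
    η ≤ σ * ⟪n, u₃⟫}
  let A2 : ℝ → Set E3 := fun σ => {r ∈ cap | ∃ n, IsOutwardNormalAt C r n ∧ ε ≤ ⟪n, u₂⟫ ∧
    η ≤ σ * ⟪n, u₃⟫}
  have hsign : ∀ x y : ℝ, x ≤ |y| → x ≤ 1 * y ∨ x ≤ (-1) * y := by
    intro x y h
    rcases abs_cases y with ⟨h1, -⟩ | ⟨h1, -⟩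
    · left; linarith
    · right; linarith
  have hcover : badSet C r₀ e₁ e₂ u₁ u₂ u₃ lam₁ lam₂ ε t ⊆
      (A3 1 ∪ A3 (-1)) ∪ ((A1 1 ∪ A1 (-1)) ∪ (A2 1 ∪ A2 (-1))) := by
    rintro r ⟨hr, hrt, n, hn, h | h | h⟩
    · right; left
      have := hηle _ _ (hk1 t ht k1 r hr hrt n hn h) (hmax r hr hrt)
      rcases hsign _ _ this with h' | h'
      · left; exact ⟨⟨hr, hrt⟩, n, hn, h, h'⟩
      · right; exact ⟨⟨hr, hrt⟩, n, hn, h, h'⟩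
    · right; right
      have := hηle _ _ (hk2 t ht k2 r hr (by linarith) n hn h) (hmax r hr hrt)
      rcases hsign _ _ this with h' | h'
      · left; exact ⟨⟨hr, hrt⟩, n, hn, h, h'⟩
      · right; exact ⟨⟨hr, hrt⟩, n, hn, h, h'⟩
    · left
      rcases hsign _ _ h with h' | h'
      · left; exact ⟨⟨hr, hrt⟩, n, hn, h'⟩
      · right; exact ⟨⟨hr, hrt⟩, n, hn, h'⟩
  have hbox : ∀ r ∈ cap, (0 ≤ co r₀ e₁ r ∧ co r₀ e₁ r ≤ H * t) ∧
      (0 ≤ co r₀ e₂ r ∧ co r₀ e₂ r ≤ H * t) :=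
    fun r hr => ⟨G.bound1 hr.1 hr.2, G.bound2 hr.1 hr.2⟩
  have v3 : ∀ σ : ℝ, σ = 1 ∨ σ = -1 → μH[2] (A3 σ) ≤ ENNReal.ofReal (Q ^ 2 * (H * t) ^ 2) := by
    intro σ hσ
    refine (bad3 G.F (A := A3 σ) (fun r hr => hr.1.1) (fun r hr => hbox r hr.1) hε hσ
      (fun r hr => hr.2)).trans (le_of_eq ?_)
    rw [ENNReal.ofReal_mul (p := Q ^ 2) (by positivity), ENNReal.ofReal_pow hQ0.le,
      ENNReal.ofReal_pow (p := H * t) (by positivity)]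
  have hval : ENNReal.ofReal Q ^ 2 *
      (ENNReal.ofReal (2 * M) ^ 2 * ENNReal.ofReal (H * t) ^ 2 * (ENNReal.ofReal η)⁻¹) =
      ENNReal.ofReal (Q ^ 2 * ((2 * M) ^ 2 * (H * t) ^ 2 * η⁻¹)) := by
    rw [ENNReal.ofReal_mul (p := Q ^ 2) (by positivity),
      ENNReal.ofReal_mul (p := (2 * M) ^ 2 * (H * t) ^ 2) (by positivity),
      ENNReal.ofReal_mul (p := (2 * M) ^ 2) (by positivity), ENNReal.ofReal_pow hQ0.le,
      ENNReal.ofReal_pow (p := 2 * M) (by positivity),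
      ENNReal.ofReal_pow (p := H * t) (by positivity),
      ENNReal.ofReal_inv_of_pos hη0]
  have v1 : ∀ σ : ℝ, σ = 1 ∨ σ = -1 → μH[2] (A1 σ) ≤
      ENNReal.ofReal (Q ^ 2 * ((2 * M) ^ 2 * (H * t) ^ 2 * η⁻¹)) := by
    intro σ hσ
    exact (bad1 G.F (A := A1 σ) (fun r hr => hr.1.1) (fun r hr => hbox r hr.1) hε hη0 hσ
      (fun r hr => hr.2)).trans (le_of_eq hval)
  have v2 : ∀ σ : ℝ, σ = 1 ∨ σ = -1 → μH[2] (A2 σ) ≤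
      ENNReal.ofReal (Q ^ 2 * ((2 * M) ^ 2 * (H * t) ^ 2 * η⁻¹)) := by
    intro σ hσ
    exact (bad1 G.F.swap (A := A2 σ) (fun r hr => hr.1.1) (fun r hr => (hbox r hr.1).symm) hε hη0 hσ
      (fun r hr => hr.2)).trans (le_of_eq hval)
  set P := Q ^ 2 * (H * t) ^ 2 with hP
  set R := Q ^ 2 * ((2 * M) ^ 2 * (H * t) ^ 2 * η⁻¹) with hR
  have hP0 : 0 ≤ P := by positivity
  have hR0 : 0 ≤ R := by positivity
  have hun : ∀ (S T : Set E3) (a b : ℝ), 0 ≤ a → 0 ≤ b → μH[2] S ≤ ENNReal.ofReal a →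
      μH[2] T ≤ ENNReal.ofReal b → μH[2] (S ∪ T) ≤ ENNReal.ofReal (a + b) := by
    intro S T a b ha hb hS hT
    rw [ENNReal.ofReal_add ha hb]
    exact (measure_union_le _ _).trans (add_le_add hS hT)
  have htot := (measure_mono hcover).trans (hun _ _ _ _ (by positivity) (by positivity)
    (hun _ _ _ _ hP0 hP0 (v3 1 (Or.inl rfl)) (v3 (-1) (Or.inr rfl)))
    (hun _ _ _ _ (by positivity) (by positivity)
      (hun _ _ _ _ hR0 hR0 (v1 1 (Or.inl rfl)) (v1 (-1) (Or.inr rfl)))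
      (hun _ _ _ _ hR0 hR0 (v2 1 (Or.inl rfl)) (v2 (-1) (Or.inr rfl)))))
  refine htot.trans ?_
  refine le_trans (ENNReal.ofReal_le_ofReal (q := δ * (c * t * L)) ?_)
    ((ENNReal.ofReal_mul hδ.le).le.trans (mul_le_mul_right hBt _))
  -- real arithmetic
  have hδK : δ * (c * t * L) = C1 * (t * L / K) := by rw [hK]; field_simp
  have hη' : η⁻¹ = L / (K * t) := by rw [hη, inv_div]
  have htt : t ^ 2 ≤ t * L / K := by
    rw [le_div_iff₀ hK0]; nlinarith
  have hR' : R = Q ^ 2 * ((2 * M) ^ 2 * H ^ 2) * (t * L / K) := by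
    rw [hR, hη']; field_simp
  have hP' : P ≤ Q ^ 2 * H ^ 2 * (t * L / K) := by
    rw [hP, mul_pow H t, ← mul_assoc]
    exact mul_le_mul_of_nonneg_left htt (by positivity)
  rw [hδK, hC1, hR']
  linarith

end cfg

section fin
variable {C : Set E3} {r₀ e₁ e₂ e₃ u₁ u₂ u₃ : E3} {M lam₁ lam₂ : ℝ}

lemma continuous_co (r₀ a : E3) : Continuous (co r₀ a) := by unfold co; fun_prop

lemma continuous_pr (r₀ a b : E3) : Continuous (pr r₀ a b) := by
  refine continuous_pi fun i => ?_
  fin_cases i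
  · exact continuous_co r₀ a
  · exact continuous_co r₀ b

lemma vol_pr_lt_top (hC : IsCompact C) (r₀ a b : E3) : volume (pr r₀ a b '' C) < ⊤ :=
  (hC.image (continuous_pr r₀ a b)).measure_lt_top

lemma piece_fin (F : DualFrame e₁ e₂ e₃ u₁ u₂ u₃ M) (hC : IsCompact C) {σ ε : ℝ} (hε : 0 < ε)
    (hσ : σ = 1 ∨ σ = -1) :
    μH[2] {r ∈ C | ∃ n, IsOutwardNormalAt C r n ∧ ε ≤ σ * ⟪n, u₁⟫} < ⊤ := by
  refine (piece F 0 (fun r hr => hr.1) hε hσ (fun r hr => hr.2)).trans_lt ?_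
  refine ENNReal.mul_lt_top (by finiteness) ?_
  exact (measure_mono (image_mono fun r hr => hr.1)).trans_lt (vol_pr_lt_top hC _ _ _)

lemma surf_fin (F : DualFrame e₁ e₂ e₃ u₁ u₂ u₃ M) (hC : IsCompact C) :
    μH[2] {r ∈ C | ∃ n, IsOutwardNormalAt C r n} < ⊤ := by
  have hM := F.hM
  have hε : 0 < 1 / (3 * M) := by positivity
  set ε := 1 / (3 * M) with hεd
  let A : E3 → ℝ → Set E3 := fun u σ => {r ∈ C | ∃ n, IsOutwardNormalAt C r n ∧ ε ≤ σ * ⟪n, u⟫}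
  have hcov : {r ∈ C | ∃ n, IsOutwardNormalAt C r n} ⊆
      (A u₁ 1 ∪ A u₁ (-1)) ∪ ((A u₂ 1 ∪ A u₂ (-1)) ∪ (A u₃ 1 ∪ A u₃ (-1))) := by
    rintro r ⟨hr, n, hn⟩
    have key : ∀ u, ε ≤ |⟪n, u⟫| → r ∈ A u 1 ∪ A u (-1) := by
      intro u h
      rcases abs_cases ⟪n, u⟫ with ⟨h1, -⟩ | ⟨h1, -⟩
      · left; exact ⟨hr, n, hn, by linarith⟩
      · right; exact ⟨hr, n, hn, by linarith⟩
    by_contra hcon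
    simp only [mem_union, not_or] at hcon
    have h1 : |⟪n, u₁⟫| < ε := not_le.1 fun h => by
      rcases key _ h with h | h
      exacts [hcon.1.1 h, hcon.1.2 h]
    have h2 : |⟪n, u₂⟫| < ε := not_le.1 fun h => by
      rcases key _ h with h | h
      exacts [hcon.2.1.1 h, hcon.2.1.2 h]
    have h3 : |⟪n, u₃⟫| < ε := not_le.1 fun h => by
      rcases key _ h with h | h
      exacts [hcon.2.2.1 h, hcon.2.2.2 h]
    have hs : ∀ (a : ℝ) (v : E3), |a| < ε → ‖v‖ ≤ M → ‖(-a) • v‖ ≤ |a| * M := by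
      intro a v _ hv
      rw [norm_smul, Real.norm_eq_abs, abs_neg]
      exact mul_le_mul_of_nonneg_left hv (abs_nonneg _)
    have hn1 : ‖n‖ ≤ |⟪n, u₁⟫| * M + |⟪n, u₂⟫| * M + |⟪n, u₃⟫| * M := by
      conv_lhs => rw [F.dec' n]
      exact norm_add₃_le.trans (add_le_add (add_le_add (hs _ _ h1 F.ne1) (hs _ _ h2 F.ne2))
        (hs _ _ h3 F.ne3))
    rw [hn.1] at hn1
    have : 3 * ε * M = 1 := by rw [hεd]; field_simp
    nlinarith
  refine (measure_mono hcov).trans_lt ?_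
  have f1 : ∀ σ : ℝ, σ = 1 ∨ σ = -1 → μH[2] (A u₁ σ) < ⊤ := fun σ hσ => piece_fin F hC hε hσ
  have f2 : ∀ σ : ℝ, σ = 1 ∨ σ = -1 → μH[2] (A u₂ σ) < ⊤ := fun σ hσ => piece_fin F.swap hC hε hσ
  have f3 : ∀ σ : ℝ, σ = 1 ∨ σ = -1 → μH[2] (A u₃ σ) < ⊤ := fun σ hσ => piece_fin F.rot hC hε hσ
  exact measure_union_lt_top (measure_union_lt_top (f1 _ (Or.inl rfl)) (f1 _ (Or.inr rfl)))
    (measure_union_lt_top (measure_union_lt_top (f2 _ (Or.inl rfl)) (f2 _ (Or.inr rfl)))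
      (measure_union_lt_top (f3 _ (Or.inl rfl)) (f3 _ (Or.inr rfl))))

lemma slice_le (G : Cfg C r₀ e₁ e₂ e₃ u₁ u₂ u₃ M lam₁ lam₂) (t : ℝ) :
    μH[2] (slice C r₀ e₁ e₂ lam₁ lam₂ t) ≤ ENNReal.ofReal (M * (lam₂ / lam₁ + 2)) ^ 2 *
      volume (pr r₀ e₂ e₃ '' slice C r₀ e₁ e₂ lam₁ lam₂ t) := by
  have hM := G.F.hM
  have hl₁ := G.hl₁
  have hl₂ := G.hl₂
  have h := haus_le (id : E3 → E3) (pr r₀ e₂ e₃) (slice C r₀ e₁ e₂ lam₁ lam₂ t)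
    (M * (lam₂ / lam₁ + 2)) (by positivity) ?_
  · rw [image_id, vol2] at h; exact h
  rintro r ⟨-, h⟩ r' ⟨-, h'⟩
  rw [id, id, dist_eq_norm]
  refine (G.F.norm_le r₀ r r').trans ?_
  rw [mul_assoc]
  refine mul_le_mul_of_nonneg_left ?_ (by linarith)
  have h0 := abs_pr0 r₀ e₂ e₃ r r'
  have h1 := abs_pr1 r₀ e₂ e₃ r r'
  have h2 : |co r₀ e₁ r - co r₀ e₁ r'| = lam₂ / lam₁ * |co r₀ e₂ r - co r₀ e₂ r'| := by
    have : co r₀ e₁ r - co r₀ e₁ r' = -(lam₂ / lam₁ * (co r₀ e₂ r - co r₀ e₂ r')) := by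
      field_simp; linarith
    rw [this, abs_neg, abs_mul, abs_of_pos (by positivity)]
  rw [h2]
  have h3 := mul_le_mul_of_nonneg_left h0 (by positivity : 0 ≤ lam₂ / lam₁)
  linarith

lemma slice_lt_top (G : Cfg C r₀ e₁ e₂ e₃ u₁ u₂ u₃ M lam₁ lam₂) (t : ℝ) :
    μH[2] (slice C r₀ e₁ e₂ lam₁ lam₂ t) < ⊤ := by
  refine (slice_le G t).trans_lt (ENNReal.mul_lt_top (by finiteness) ?_)
  exact (measure_mono (image_mono fun r hr => hr.1)).trans_lt (vol_pr_lt_top G.hC.1 _ _ _)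

lemma exists_step {r v : E3} (hr : r ∈ interior C) : ∃ s > (0:ℝ), r + s • v ∈ C := by
  have hc : Tendsto (fun s : ℝ => r + s • v) (𝓝[>] 0) (𝓝 r) := by
    have : Continuous (fun s : ℝ => r + s • v) := by fun_prop
    have h := this.tendsto 0
    simp only [zero_smul, add_zero] at h
    exact h.mono_left nhdsWithin_le_nhds
  have h1 := hc.eventually (mem_interior_iff_mem_nhds.1 hr)
  obtain ⟨s, hs, h0⟩ := (h1.and self_mem_nhdsWithin).exists
  exact ⟨s, h0, hs⟩

lemma normal_frontier {r n : E3} (hr : r ∈ C) (hn : IsOutwardNormalAt C r n) : r ∈ frontier C := by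
  refine ⟨subset_closure hr, fun hi => ?_⟩
  obtain ⟨s, hs, h⟩ := exists_step (v := n) hi
  have := hn.2 _ h
  rw [add_sub_cancel_left, inner_smul_left, real_inner_self_eq_norm_sq, hn.1] at this
  simp at this
  linarith

lemma normal_not_neg (hC : IsConvexBody C) {r n : E3} (hn : IsOutwardNormalAt C r n)
    (hn' : IsOutwardNormalAt C r (-n)) : False := by
  obtain ⟨x, hx⟩ := hC.2.2
  obtain ⟨s, hs, h⟩ := exists_step (v := n) hx
  have h1 := hn'.2 x (interior_subset hx)
  have h2 := hn.2 _ h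
  rw [add_sub_right_comm, inner_add_left, inner_smul_left, real_inner_self_eq_norm_sq, hn.1] at h2
  rw [inner_neg_right] at h1
  simp at h2
  linarith

lemma exists_normal (hC : IsConvexBody C) {r : E3} (hr : r ∉ interior C) :
    ∃ n, IsOutwardNormalAt C r n := by
  obtain ⟨f, hf⟩ := geometric_hahn_banach_open_point hC.2.1.interior isOpen_interior hr
  set m := (InnerProductSpace.toDual ℝ E3).symm f with hm
  have hfm : ∀ x, f x = ⟪m, x⟫ := fun x => by
    rw [hm, InnerProductSpace.toDual_symm_apply]
  have hm0 : m ≠ 0 := by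
    intro h0
    obtain ⟨x, hx⟩ := hC.2.2
    have := hf x hx
    rw [hfm, hfm, h0] at this
    simp at this
  have hle : ∀ x ∈ C, f x ≤ f r := by
    intro x hx
    have hx' : x ∈ closure (interior C) := by
      rw [hC.2.1.closure_interior_eq_closure_of_nonempty_interior hC.2.2]
      exact subset_closure hx
    have : closure (interior C) ⊆ {x | f x ≤ f r} :=
      closure_minimal (fun y hy => (hf y hy).le) (isClosed_le f.continuous continuous_const)
    exact this hx'
  have hpos : 0 < ‖m‖ := norm_pos_iff.2 hm0
  refine ⟨‖m‖⁻¹ • m, ?_, fun x hx => ?_⟩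
  · rw [norm_smul, norm_inv, norm_norm, inv_mul_cancel₀ hpos.ne']
  · rw [inner_smul_right, inner_sub_left, real_inner_comm, real_inner_comm m r, ← hfm, ← hfm]
    exact mul_nonpos_of_nonneg_of_nonpos (by positivity) (by linarith [hle x hx])

end fin

section graph
variable {C : Set E3} {r₀ e₁ e₂ e₃ u₁ u₂ u₃ : E3} {M lam₁ lam₂ : ℝ}

/-- lower graph function of `C` in the direction of the first coordinate -/
def gfun (C : Set E3) (r₀ u₁ u₂ u₃ : E3) (w : Fin 2 → ℝ) : ℝ :=
  sInf {x : ℝ | pt r₀ u₁ u₂ u₃ x (w 0) (w 1) ∈ C}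

/-- graph point -/
def gpt (C : Set E3) (r₀ u₁ u₂ u₃ : E3) (w : Fin 2 → ℝ) : E3 :=
  pt r₀ u₁ u₂ u₃ (gfun C r₀ u₁ u₂ u₃ w) (w 0) (w 1)

lemma gfun_bdd (G : Cfg C r₀ e₁ e₂ e₃ u₁ u₂ u₃ M lam₁ lam₂) (w : Fin 2 → ℝ) :
    BddBelow {x : ℝ | pt r₀ u₁ u₂ u₃ x (w 0) (w 1) ∈ C} := by
  refine ⟨0, fun x hx => ?_⟩
  have := (co_nonneg G.hcone hx).1
  rwa [G.F.co1] at this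

lemma gfun_le (G : Cfg C r₀ e₁ e₂ e₃ u₁ u₂ u₃ M lam₁ lam₂) {r : E3} (hr : r ∈ C) :
    gfun C r₀ u₁ u₂ u₃ (pr r₀ e₂ e₃ r) ≤ co r₀ e₁ r := by
  refine csInf_le (gfun_bdd G _) ?_
  change pt r₀ u₁ u₂ u₃ (co r₀ e₁ r) (co r₀ e₂ r) (co r₀ e₃ r) ∈ C
  rw [G.F.pt_co]
  exact hr

lemma gpt_mem (G : Cfg C r₀ e₁ e₂ e₃ u₁ u₂ u₃ M lam₁ lam₂) {w : Fin 2 → ℝ}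
    (hw : w ∈ pr r₀ e₂ e₃ '' C) : gpt C r₀ u₁ u₂ u₃ w ∈ C := by
  obtain ⟨r, hr, rfl⟩ := hw
  have hcl : IsClosed {x : ℝ | pt r₀ u₁ u₂ u₃ x (pr r₀ e₂ e₃ r 0) (pr r₀ e₂ e₃ r 1) ∈ C} := by
    refine G.hC.1.isClosed.preimage (f := fun x => pt r₀ u₁ u₂ u₃ x _ _) ?_
    unfold pt; fun_prop
  refine hcl.csInf_mem ⟨co r₀ e₁ r, ?_⟩ (gfun_bdd G _)
  change pt r₀ u₁ u₂ u₃ (co r₀ e₁ r) (co r₀ e₂ r) (co r₀ e₃ r) ∈ C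
  rw [G.F.pt_co]
  exact hr

lemma pr_gpt (G : Cfg C r₀ e₁ e₂ e₃ u₁ u₂ u₃ M lam₁ lam₂) (w : Fin 2 → ℝ) :
    pr r₀ e₂ e₃ (gpt C r₀ u₁ u₂ u₃ w) = w := by
  ext i
  fin_cases i
  · exact G.F.co2 _ _ _ _
  · exact G.F.co3 _ _ _ _

lemma co_gpt (G : Cfg C r₀ e₁ e₂ e₃ u₁ u₂ u₃ M lam₁ lam₂) (w : Fin 2 → ℝ) :
    co r₀ e₁ (gpt C r₀ u₁ u₂ u₃ w) = gfun C r₀ u₁ u₂ u₃ w := G.F.co1 _ _ _ _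

lemma gfun_convex (G : Cfg C r₀ e₁ e₂ e₃ u₁ u₂ u₃ M lam₁ lam₂) :
    ConvexOn ℝ (pr r₀ e₂ e₃ '' C) (gfun C r₀ u₁ u₂ u₃) := by
  refine ⟨convex_pr_image G.hC.2.1 _ _, fun w hw w' hw' a b ha hb hab => ?_⟩
  have h := gfun_le G (G.hC.2.1 (gpt_mem G hw) (gpt_mem G hw') ha hb hab)
  rw [co_combo _ _ _ hab, co_gpt G, co_gpt G] at h
  have h2 : pr r₀ e₂ e₃ (a • gpt C r₀ u₁ u₂ u₃ w + b • gpt C r₀ u₁ u₂ u₃ w') = a • w + b • w' := by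
    conv_rhs => rw [← pr_gpt G w, ← pr_gpt G w']
    ext i
    fin_cases i <;> simp [pr, co_combo _ _ _ hab]
  rw [h2] at h
  simpa using h

lemma gfun_ae (G : Cfg C r₀ e₁ e₂ e₃ u₁ u₂ u₃ M lam₁ lam₂) :
    volume {w ∈ interior (pr r₀ e₂ e₃ '' C) | ¬ DifferentiableAt ℝ (gfun C r₀ u₁ u₂ u₃) w} = 0 := by
  set g := gfun C r₀ u₁ u₂ u₃ with hg
  refine measure_null_of_locally_null _ fun w hw => ?_
  obtain ⟨K, s, hs, hL⟩ := (gfun_convex G).locallyLipschitzOn_interior hw.1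
  rw [isOpen_interior.nhdsWithin_eq hw.1] at hs
  refine ⟨{w' ∈ interior s | ¬ DifferentiableAt ℝ g w'}, ?_, ?_⟩
  · filter_upwards [self_mem_nhdsWithin, mem_nhdsWithin_of_mem_nhds (interior_mem_nhds.2 hs)]
      with x hx hx'
    exact ⟨hx', hx.2⟩
  · have := hL.ae_differentiableWithinAt_of_mem (μ := volume)
    refine measure_mono_null ?_ (ae_iff.1 this)
    rintro x ⟨hx, hx'⟩ hcon
    exact hx' ((hcon (interior_subset hx)).differentiableAt (mem_interior_iff_mem_nhds.1 hx))

lemma gpt_regular (G : Cfg C r₀ e₁ e₂ e₃ u₁ u₂ u₃ M lam₁ lam₂) {w : Fin 2 → ℝ}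
    (hw : w ∈ interior (pr r₀ e₂ e₃ '' C)) (hd : DifferentiableAt ℝ (gfun C r₀ u₁ u₂ u₃) w) :
    gpt C r₀ u₁ u₂ u₃ w ∈ frontier C ∧ IsRegularPt C (gpt C r₀ u₁ u₂ u₃ w) := by
  set r := gpt C r₀ u₁ u₂ u₃ w with hr
  have hrC : r ∈ C := gpt_mem G (interior_subset hw)
  have hni : r ∉ interior C := by
    intro hi
    obtain ⟨s, hs, h⟩ := exists_step (v := -u₁) hi
    have h1 := gfun_le G h
    have e : ∀ a, co r₀ a (r + s • -u₁) = co r₀ a r + s * ⟪u₁, a⟫ := by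
      intro a
      simp only [co, add_sub_right_comm, inner_add_left, inner_smul_left, inner_neg_left]
      simp
      ring
    have h2 : pr r₀ e₂ e₃ (r + s • -u₁) = w := by
      rw [← pr_gpt G w, ← hr]
      ext i
      fin_cases i
      · change co r₀ e₂ _ = co r₀ e₂ _
        rw [e, G.F.h12]; ring
      · change co r₀ e₃ _ = co r₀ e₃ _
        rw [e, G.F.h13]; ring
    rw [h2, e, G.F.h11, hr, co_gpt G] at h1
    linarith
  obtain ⟨n₀, hn₀⟩ := exists_normal G.hC hni
  set L := fderiv ℝ (gfun C r₀ u₁ u₂ u₃) w with hL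
  have key : ∀ n, IsOutwardNormalAt C r n → ∀ v : Fin 2 → ℝ,
      ⟪n, u₁⟫ * L v + ⟪n, u₂⟫ * v 0 + ⟪n, u₃⟫ * v 1 = 0 := by
    intro n hn v
    let P0 : (Fin 2 → ℝ) →L[ℝ] ℝ := ContinuousLinearMap.proj 0
    let P1 : (Fin 2 → ℝ) →L[ℝ] ℝ := ContinuousLinearMap.proj 1
    have hder : HasFDerivAt (fun w' => ⟪n, u₁⟫ * gfun C r₀ u₁ u₂ u₃ w' + ⟪n, u₂⟫ * w' 0 +
        ⟪n, u₃⟫ * w' 1) (⟪n, u₁⟫ • L + ⟪n, u₂⟫ • P0 + ⟪n, u₃⟫ • P1) w :=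
      ((hd.hasFDerivAt.const_mul _).add (P0.hasFDerivAt.const_mul _)).add
        (P1.hasFDerivAt.const_mul _)
    have hmax : IsLocalMax (fun w' => ⟪n, u₁⟫ * gfun C r₀ u₁ u₂ u₃ w' + ⟪n, u₂⟫ * w' 0 +
        ⟪n, u₃⟫ * w' 1) w := by
      filter_upwards [mem_interior_iff_mem_nhds.1 hw] with w' hw'
      have h1 := hn.2 _ (gpt_mem G hw')
      rw [G.F.inner_eq r₀, hr, co_gpt G, co_gpt G] at h1
      have c2 : ∀ w, co r₀ e₂ (gpt C r₀ u₁ u₂ u₃ w) = w 0 := fun w => G.F.co2 _ _ _ _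
      have c3 : ∀ w, co r₀ e₃ (gpt C r₀ u₁ u₂ u₃ w) = w 1 := fun w => G.F.co3 _ _ _ _
      rw [c2, c2, c3, c3] at h1
      linarith
    have h0 := hmax.hasFDerivAt_eq_zero hder
    have := congrArg (fun T : (Fin 2 → ℝ) →L[ℝ] ℝ => T v) h0
    simpa [P0, P1] using this
  have hcol : ∀ n, IsOutwardNormalAt C r n → n = ⟪n, u₁⟫ •
      (-e₁ + (L ![1, 0]) • e₂ + (L ![0, 1]) • e₃) := by
    intro n hn
    have k1 := key n hn ![1, 0]
    have k2 := key n hn ![0, 1]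
    simp at k1 k2
    have q1 : -⟪n, u₂⟫ = ⟪n, u₁⟫ * L ![1, 0] := by linarith
    have q2 : -⟪n, u₃⟫ = ⟪n, u₁⟫ * L ![0, 1] := by linarith
    conv_lhs => rw [G.F.dec' n, q1, q2]
    simp only [smul_add, smul_smul, neg_smul, smul_neg]
  refine ⟨normal_frontier hrC hn₀, n₀, hn₀, fun n hn => ?_⟩
  set m := -e₁ + (L ![1, 0]) • e₂ + (L ![0, 1]) • e₃ with hm
  have a1 := hcol n hn
  have a0 := hcol n₀ hn₀
  have b1 : |⟪n, u₁⟫| * ‖m‖ = 1 := by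
    rw [← Real.norm_eq_abs, ← norm_smul, ← a1, hn.1]
  have b0 : |⟪n₀, u₁⟫| * ‖m‖ = 1 := by
    rw [← Real.norm_eq_abs, ← norm_smul, ← a0, hn₀.1]
  have hm0 : ‖m‖ ≠ 0 := fun h => by rw [h] at b1; simp at b1
  have habs : |⟪n, u₁⟫| = |⟪n₀, u₁⟫| := mul_right_cancel₀ hm0 (b1.trans b0.symm)
  rcases abs_eq_abs.1 habs with h | h
  · rw [a1, h, ← a0]
  · exfalso
    have : n = -n₀ := by
      rw [a1, h, neg_smul, ← a0]
    rw [this] at hn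
    exact normal_not_neg G.hC hn₀ hn

lemma reg_lower (G : Cfg C r₀ e₁ e₂ e₃ u₁ u₂ u₃ M lam₁ lam₂) (t : ℝ) :
    μH[2] (slice C r₀ e₁ e₂ lam₁ lam₂ t) ≤
      ENNReal.ofReal (M * (lam₂ / lam₁ + 2)) ^ 2 * (ENNReal.ofReal M ^ 2 *
        μH[2] ({r ∈ frontier C | lam₁ * co r₀ e₁ r + lam₂ * co r₀ e₂ r ≤ t} ∩
          {r | IsRegularPt C r})) := by
  refine (slice_le G t).trans (mul_le_mul_right ?_ _)
  have hM := G.F.hM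
  refine le_trans ?_ (vol_pr_le (r₀ := r₀) (by linarith) G.F.ne2 G.F.ne3 _)
  have hP := convex_pr_image (r₀ := r₀) G.hC.2.1 e₂ e₃
  have hnull : volume (frontier (pr r₀ e₂ e₃ '' C) ∪
      {w ∈ interior (pr r₀ e₂ e₃ '' C) | ¬ DifferentiableAt ℝ (gfun C r₀ u₁ u₂ u₃) w}) = 0 :=
    measure_union_null (hP.addHaar_frontier volume) (gfun_ae G)
  set N := frontier (pr r₀ e₂ e₃ '' C) ∪
      {w ∈ interior (pr r₀ e₂ e₃ '' C) | ¬ DifferentiableAt ℝ (gfun C r₀ u₁ u₂ u₃) w} with hN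
  refine le_trans (measure_mono (t := pr r₀ e₂ e₃ '' ({r ∈ frontier C |
    lam₁ * co r₀ e₁ r + lam₂ * co r₀ e₂ r ≤ t} ∩ {r | IsRegularPt C r}) ∪ N) ?_) ?_
  · rintro _ ⟨b, ⟨hb, hbt⟩, rfl⟩
    by_cases hbN : pr r₀ e₂ e₃ b ∈ N
    · right; exact hbN
    left
    simp only [hN, mem_union, not_or] at hbN
    have hintg : pr r₀ e₂ e₃ b ∈ interior (pr r₀ e₂ e₃ '' C) := by
      by_contra h
      exact hbN.1 ⟨subset_closure ⟨b, hb, rfl⟩, h⟩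
    have hdiff : DifferentiableAt ℝ (gfun C r₀ u₁ u₂ u₃) (pr r₀ e₂ e₃ b) := by
      by_contra h
      exact hbN.2 ⟨hintg, h⟩
    obtain ⟨h1, h2⟩ := gpt_regular G hintg hdiff
    refine ⟨_, ⟨⟨h1, ?_⟩, h2⟩, pr_gpt G _⟩
    have c2 : co r₀ e₂ (gpt C r₀ u₁ u₂ u₃ (pr r₀ e₂ e₃ b)) = co r₀ e₂ b := G.F.co2 _ _ _ _
    rw [co_gpt G, c2]
    have := mul_le_mul_of_nonneg_left (gfun_le G hb) G.hl₁.le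
    linarith
  · refine (measure_union_le _ _).trans ?_
    rw [hnull, add_zero]

end graph

section final
variable {C : Set E3} {r₀ e₁ e₂ e₃ u₁ u₂ u₃ : E3} {M lam₁ lam₂ : ℝ}

lemma inner_e (r₀ e₁ e₂ : E3) (lam₁ lam₂ : ℝ) (r : E3) :
    ⟪r - r₀, lam₁ • e₁ + lam₂ • e₂⟫ = -(lam₁ * co r₀ e₁ r + lam₂ * co r₀ e₂ r) := by
  simp only [co, inner_add_right, inner_smul_right]; ring

lemma Bset_eq (C : Set E3) (r₀ e₁ e₂ : E3) (lam₁ lam₂ t : ℝ) :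
    Bset C r₀ (lam₁ • e₁ + lam₂ • e₂) t = slice C r₀ e₁ e₂ lam₁ lam₂ t := by
  ext r
  change r ∈ C ∧ ⟪r - r₀, lam₁ • e₁ + lam₂ • e₂⟫ = -t ↔ r ∈ C ∧ _ = t
  rw [inner_e, neg_inj]

lemma Sset_eq (C : Set E3) (r₀ e₁ e₂ : E3) (lam₁ lam₂ t : ℝ) :
    Sset C r₀ (lam₁ • e₁ + lam₂ • e₂) t =
      {r ∈ frontier C | lam₁ * co r₀ e₁ r + lam₂ * co r₀ e₂ r ≤ t} := by
  ext r
  change r ∈ frontier C ∧ ⟪r - r₀, lam₁ • e₁ + lam₂ • e₂⟫ ≥ -t ↔ r ∈ frontier C ∧ _ ≤ t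
  rw [inner_e, ge_iff_le, neg_le_neg_iff]

/-- the test function -/
def tf (u₁ u₂ u₃ n : E3) : ℝ :=
  min 1 (max ⟪n, u₁⟫ 0 + max ⟪n, u₂⟫ 0 + |⟪n, u₃⟫| + |‖n‖ - 1|)

lemma tf_nonneg (u₁ u₂ u₃ n : E3) : 0 ≤ tf u₁ u₂ u₃ n := by
  unfold tf; positivity

lemma tf_continuous (u₁ u₂ u₃ : E3) : Continuous (tf u₁ u₂ u₃) := by
  unfold tf; fun_prop

/-- the test function as a bounded continuous function -/
def tfb (u₁ u₂ u₃ : E3) : BoundedContinuousFunction E3 ℝ :=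
  BoundedContinuousFunction.ofNormedAddCommGroup (tf u₁ u₂ u₃) (tf_continuous u₁ u₂ u₃) 1 (by
    intro n
    rw [Real.norm_of_nonneg (tf_nonneg _ _ _ _)]
    exact min_le_left _ _)

/-- far normals -/
def farT (u₁ u₂ u₃ : E3) (ε : ℝ) : Set E3 :=
  {n | ε ≤ ⟪n, u₁⟫} ∪ ({n | ε ≤ ⟪n, u₂⟫} ∪ ({n | ε ≤ |⟪n, u₃⟫|} ∪ {n | ‖n‖ = 1}ᶜ))

lemma measurableSet_farT (u₁ u₂ u₃ : E3) (ε : ℝ) : MeasurableSet (farT u₁ u₂ u₃ ε) := by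
  refine MeasurableSet.union ?_ (MeasurableSet.union ?_ (MeasurableSet.union ?_
    (MeasurableSet.compl ?_)))
  · exact (isClosed_le continuous_const (by fun_prop)).measurableSet
  · exact (isClosed_le continuous_const (by fun_prop)).measurableSet
  · exact (isClosed_le continuous_const (by fun_prop)).measurableSet
  · exact (isClosed_eq (by fun_prop) continuous_const).measurableSet

lemma tf_le {ε : ℝ} (hε : 0 < ε) (u₁ u₂ u₃ n : E3) :
    tf u₁ u₂ u₃ n ≤ 3 * ε + (farT u₁ u₂ u₃ ε).indicator (fun _ => (1 : ℝ)) n := by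
  by_cases h : n ∈ farT u₁ u₂ u₃ ε
  · rw [indicator_of_mem h]
    have : tf u₁ u₂ u₃ n ≤ 1 := min_le_left _ _
    linarith
  · rw [indicator_of_notMem h]
    simp only [farT, mem_union, not_or, mem_ofPred_eq, not_le, mem_compl_iff, not_not] at h
    obtain ⟨h1, h2, h3, h4⟩ := h
    have := min_le_right 1 (max ⟪n, u₁⟫ 0 + max ⟪n, u₂⟫ 0 + |⟪n, u₃⟫| + |‖n‖ - 1|)
    have m1 := max_le h1.le hε.le
    have m2 := max_le h2.le hε.le
    have m4 : |‖n‖ - 1| = 0 := by rw [h4]; simp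
    unfold tf
    linarith

lemma mem_arc_of_tf (F : DualFrame e₁ e₂ e₃ u₁ u₂ u₃ M) {n : E3} (h : tf u₁ u₂ u₃ n = 0) :
    n ∈ arcGamma e₁ e₂ := by
  have a1 := le_max_left ⟪n, u₁⟫ 0
  have a2 := le_max_left ⟪n, u₂⟫ 0
  have b1 := le_max_right ⟪n, u₁⟫ 0
  have b2 := le_max_right ⟪n, u₂⟫ 0
  have b3 := abs_nonneg ⟪n, u₃⟫
  have b4 := abs_nonneg (‖n‖ - 1)
  have hs : max ⟪n, u₁⟫ 0 + max ⟪n, u₂⟫ 0 + |⟪n, u₃⟫| + |‖n‖ - 1| = 0 := by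
    unfold tf at h
    rcases min_choice 1 (max ⟪n, u₁⟫ 0 + max ⟪n, u₂⟫ 0 + |⟪n, u₃⟫| + |‖n‖ - 1|) with h' | h'
    · rw [h'] at h; norm_num at h
    · rw [h'] at h; exact h
  have c3 : ⟪n, u₃⟫ = 0 := abs_eq_zero.1 (by linarith)
  have c4 : ‖n‖ - 1 = 0 := abs_eq_zero.1 (by linarith)
  refine ⟨-⟪n, u₁⟫, -⟪n, u₂⟫, by linarith, by linarith, ?_, by linarith⟩
  have := F.dec' n
  rw [c3] at this
  simpa using this

lemma nuT_apply (hC : IsCompact C) (r₀ e : E3) (t : ℝ) {T : Set E3} (hT : MeasurableSet T) :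
    nuT C r₀ e t T = (μH[2] (Bset C r₀ e t))⁻¹ *
      μH[2] (normalMap C ⁻¹' T ∩ (Sset C r₀ e t ∩ {r : E3 | IsRegularPt C r})) := by
  rw [nuT, Measure.smul_apply, smul_eq_mul,
    Measure.map_apply_of_aemeasurable (aemeasurable_normalMap hC r₀ e t) hT,
    Measure.restrict_apply' (measurableSet_sreg hC r₀ e t)]

lemma reg_fin (G : Cfg C r₀ e₁ e₂ e₃ u₁ u₂ u₃ M lam₁ lam₂) (e : E3) (t : ℝ) :
    μH[2] (Sset C r₀ e t ∩ {r : E3 | IsRegularPt C r}) < ⊤ := by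
  refine (measure_mono ?_).trans_lt (surf_fin G.F G.hC.1)
  rintro r ⟨⟨hr, -⟩, hreg⟩
  exact ⟨G.hC.1.isClosed.frontier_subset hr, normalMap C r, normalMap_spec hreg⟩

lemma main_aux (G : Cfg C r₀ e₁ e₂ e₃ u₁ u₂ u₃ M lam₁ lam₂) (ν₀ : Measure E3)
    (hν : IsPartialWeakLimit (nuT C r₀ (lam₁ • e₁ + lam₂ • e₂)) ν₀) :
    ν₀ (arcGamma e₁ e₂)ᶜ = 0 := by
  obtain ⟨ts, hpos, hts, hlim⟩ := hν
  set e := lam₁ • e₁ + lam₂ • e₂ with he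
  set ν := nuT C r₀ e with hνd
  have hM := G.F.hM
  have hl₁ := G.hl₁
  have hl₂ := G.hl₂
  have hev : ∀ t₀ > 0, ∀ᶠ i in atTop, ts i ≤ t₀ := fun t₀ ht₀ =>
    (hts.eventually (gt_mem_nhds ht₀)).mono fun i hi => hi.le
  -- positivity and finiteness of the section area
  obtain ⟨tz, htz, hz⟩ := bad_small G one_pos one_pos
  have hbne : ∀ t, 0 < t → t ≤ tz → μH[2] (Bset C r₀ e t) ≠ 0 := by
    intro t h1 h2
    rw [he, Bset_eq]
    exact (hz t h1 h2).1
  have hbtop : ∀ t, μH[2] (Bset C r₀ e t) ≠ ⊤ := by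
    intro t
    rw [he, Bset_eq]
    exact (slice_lt_top G t).ne
  have huniv : ∀ t, ν t univ = (μH[2] (Bset C r₀ e t))⁻¹ *
      μH[2] (Sset C r₀ e t ∩ {r : E3 | IsRegularPt C r}) := by
    intro t
    rw [hνd, nuT_apply G.hC.1 r₀ e t MeasurableSet.univ, preimage_univ, univ_inter]
  have hfin : ∀ t, 0 < t → t ≤ tz → IsFiniteMeasure (ν t) := by
    intro t h1 h2
    refine ⟨?_⟩
    rw [huniv]
    exact ENNReal.mul_lt_top (ENNReal.inv_lt_top.2 (pos_iff_ne_zero.2 (hbne t h1 h2)))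
      (reg_fin G e t)
  -- lower bound on the total mass
  set Kr : ℝ := (M * (lam₂ / lam₁ + 2)) ^ 2 * M ^ 2 with hKr
  have hKr0 : 0 < Kr := by positivity
  have hlow : ∀ t, 0 < t → t ≤ tz → 1 / Kr ≤ (ν t).real univ := by
    intro t h1 h2
    have hf := hfin t h1 h2
    have h3 := reg_lower G t
    rw [← Bset_eq, ← Sset_eq, ← he, ← mul_assoc] at h3
    have hK : ENNReal.ofReal (M * (lam₂ / lam₁ + 2)) ^ 2 * ENNReal.ofReal M ^ 2 =
        ENNReal.ofReal Kr := by
      rw [hKr, ENNReal.ofReal_mul (p := (M * (lam₂ / lam₁ + 2)) ^ 2) (by positivity),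
        ENNReal.ofReal_pow (p := M * (lam₂ / lam₁ + 2)) (by positivity),
        ENNReal.ofReal_pow (p := M) (by positivity)]
    rw [hK] at h3
    have h4 : 1 ≤ ENNReal.ofReal Kr * ν t univ := by
      rw [huniv, mul_left_comm, ← ENNReal.inv_mul_cancel (hbne t h1 h2) (hbtop t)]
      exact mul_le_mul_right h3 _
    have h5 := ENNReal.toReal_mono (by finiteness) h4
    rw [ENNReal.toReal_mul, ENNReal.toReal_ofReal hKr0.le, ENNReal.toReal_one] at h5
    rw [div_le_iff₀ hKr0, mul_comm]
    exact h5
  -- total masses converge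
  have hone := hlim (BoundedContinuousFunction.const E3 (1 : ℝ))
  have hone' : Tendsto (fun i => (ν (ts i)).real univ) atTop (𝓝 (ν₀.real univ)) := by
    simpa using hone
  have hc : 1 / Kr ≤ ν₀.real univ := by
    refine ge_of_tendsto hone' ?_
    filter_upwards [hev tz htz] with i hi
    exact hlow _ (hpos i) hi
  have hν₀fin : IsFiniteMeasure ν₀ := by
    refine ⟨lt_of_le_of_ne le_top fun htop => ?_⟩
    rw [Measure.real, htop, ENNReal.toReal_top] at hc
    have : 0 < 1 / Kr := by positivity
    linarith
  set c := ν₀.real univ with hcd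
  have hc0 : 0 ≤ c := measureReal_nonneg
  -- bound of the test integrals
  have hbound : ∀ ε > 0, ∀ δ > 0, ∫ x, tf u₁ u₂ u₃ x ∂ν₀ ≤ 3 * ε * c + δ := by
    intro ε hε δ hδ
    obtain ⟨t₁, ht₁, hb⟩ := bad_small G hε hδ
    refine le_of_tendsto_of_tendsto (hlim (tfb u₁ u₂ u₃))
      ((hone'.const_mul (3 * ε)).add_const δ) ?_
    filter_upwards [hev tz htz, hev t₁ ht₁] with i hi hi'
    have hf := hfin _ (hpos i) hi
    have hT := measurableSet_farT u₁ u₂ u₃ ε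
    have hνT : (ν (ts i)).real (farT u₁ u₂ u₃ ε) ≤ δ := by
      refine ENNReal.toReal_le_of_le_ofReal hδ.le ?_
      rw [hνd, nuT_apply G.hC.1 r₀ e _ hT]
      have h1 := (hb _ (hpos i) hi').2
      rw [← Bset_eq, ← he] at h1
      have h2 : μH[2] (normalMap C ⁻¹' farT u₁ u₂ u₃ ε ∩
          (Sset C r₀ e (ts i) ∩ {r : E3 | IsRegularPt C r})) ≤
          ENNReal.ofReal δ * μH[2] (Bset C r₀ e (ts i)) := by
        refine (measure_mono ?_).trans h1
        rintro r ⟨hr, hS, hreg⟩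
        rw [he, Sset_eq] at hS
        have hn := normalMap_spec hreg
        refine ⟨G.hC.1.isClosed.frontier_subset hS.1, hS.2, normalMap C r, hn, ?_⟩
        rcases hr with h | h | h | h
        · exact Or.inl h
        · exact Or.inr (Or.inl h)
        · exact Or.inr (Or.inr h)
        · exact absurd hn.1 h
      refine (mul_le_mul_right h2 _).trans (le_of_eq ?_)
      rw [mul_left_comm, ENNReal.inv_mul_cancel (hbne _ (hpos i) hi) (hbtop _), mul_one]
    have hintg : Integrable ((farT u₁ u₂ u₃ ε).indicator (fun _ => (1 : ℝ))) (ν (ts i)) :=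
      (integrable_const _).indicator hT
    have h3 : ∫ x, tf u₁ u₂ u₃ x ∂(ν (ts i)) ≤
        ∫ x, (3 * ε + (farT u₁ u₂ u₃ ε).indicator (fun _ => (1 : ℝ)) x) ∂(ν (ts i)) :=
      integral_mono ((tfb u₁ u₂ u₃).integrable _) ((integrable_const _).add hintg)
        (fun x => tf_le hε u₁ u₂ u₃ x)
    rw [integral_add (integrable_const _) hintg, integral_const, integral_indicator_const _ hT,
      smul_eq_mul, smul_eq_mul, mul_one] at h3
    change ∫ x, tf u₁ u₂ u₃ x ∂(ν (ts i)) ≤ _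
    linarith
  have hzero : ∫ x, tf u₁ u₂ u₃ x ∂ν₀ = 0 := by
    refine le_antisymm (le_of_forall_pos_le_add fun η hη => ?_)
      (integral_nonneg fun x => tf_nonneg _ _ _ _)
    refine (hbound (η / (6 * (c + 1))) (by positivity) (η / 2) (by positivity)).trans ?_
    have : 3 * (η / (6 * (c + 1))) * c ≤ η / 2 := by
      have h1 : 3 * (η / (6 * (c + 1))) * c = η / 2 * (c / (c + 1)) := by field_simp; ring
      have h2 : c / (c + 1) ≤ 1 := by rw [div_le_one (by linarith)]; linarith
      rw [h1]
      exact mul_le_of_le_one_right (by linarith) h2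
    linarith
  have hae := (integral_eq_zero_iff_of_nonneg (fun x => tf_nonneg u₁ u₂ u₃ x)
    ((tfb u₁ u₂ u₃).integrable ν₀)).1 hzero
  refine measure_mono_null ?_ (ae_iff.1 hae)
  intro n hn h0
  exact hn (mem_arc_of_tf G.F h0)

end final

/-- **Lemma 2 of the paper.** Every partial weak limit of `ν_t` as `t → 0⁺` is supported
in the arc `Γ = {μ₁e₁ + μ₂e₂ : |μ₁e₁ + μ₂e₂| = 1, μ₁ ≥ 0, μ₂ ≥ 0}`. -/
theorem partial_weak_limit_supported_in_arc
    (C : Set E3) (r₀ e₁ e₂ e : E3) (lam₁ lam₂ : ℝ)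
    (hC : IsConvexBody C) (hr₀ : r₀ ∈ frontier C)
    (he₁ : ‖e₁‖ = 1) (he₂ : ‖e₂‖ = 1) (hne : e₁ ≠ e₂) (hne' : e₁ ≠ -e₂)
    (hcone : tanCone C r₀ = dihedral e₁ e₂)
    (hl₁ : 0 < lam₁) (hl₂ : 0 < lam₂) (he : e = lam₁ • e₁ + lam₂ • e₂) (hnorm : ‖e‖ = 1) :
    ∀ ν₀ : Measure E3, IsPartialWeakLimit (nuT C r₀ e) ν₀ →
      ν₀ (arcGamma e₁ e₂)ᶜ = 0 := by
  subst he
  obtain ⟨e₃, u₁, u₂, u₃, M, F⟩ := exists_frame he₁ he₂ hne hne'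
  exact main_aux ⟨F, hC, hC.1.isClosed.frontier_subset hr₀, hcone, hl₁, hl₂⟩
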